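/- arXiv:0910.2533 — 2 statements merged into one kernel-verified Lean document; each statement's English description precedes it below -/
import Mathlib

section
/- Let k ≥ 1 be an integer, 1 < p ≤ ∞, α ∈ (0, π) ∪ (π, 2π), λ₀ ∈ ℝ, d > 0, and Γ = {λ₀ + s e^{iα} : s > 0}. Let f : ℝ → ℂ be compactly supported, (k−1)-times continuously differentiable with f^{(k−1)} locally absolutely continuous and f^{(k)} ∈ L¹(ℝ). Let U be an open neighborhood of supp f, suppose θ : ℝ → ℝ is (k+1)-times continuously differentiable on U with θ'(x) ≠ 0 for all x ∈ supp f, and assume dist(supp f, λ₀) ≥ d. Then there is a constant C, depending on k, p, α, d, f, θ but not on t, such that for every t ≥ 1, the L^p norm with respect to arclength measure on Γ of λ ↦ (1/(2πi)) ∫_ℝ f(x) e^{itθ(x)} / (x − λ) dx is at most C t^{−k}. -/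
open MeasureTheory Set

/-- `SobolevOn K j h`: the function `h` has `j` integrable derivatives (the last one in the
absolutely continuous sense), all of them vanishing off `K`. -/
def SobolevOn (K : Set ℝ) : ℕ → (ℝ → ℂ) → Prop
  | 0, h => Integrable h volume ∧ ∀ᵐ x, x ∉ K → h x = 0
  | j + 1, h => (∀ x ∉ K, h x = 0) ∧
      ∃ h' : ℝ → ℂ, SobolevOn K j h' ∧ ∀ a b : ℝ, h b - h a = ∫ x in a..b, h' x

theorem continuous_of_sub_eq_integral {h h' : ℝ → ℂ} (hi : Integrable h' volume)
    (hh : ∀ a b : ℝ, h b - h a = ∫ x in a..b, h' x) : Continuous h := by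
  have : h = fun x => h 0 + ∫ y in (0 : ℝ)..x, h' y := by
    funext x; rw [← hh 0 x]; ring
  rw [this]
  exact continuous_const.add (hi.continuous_primitive 0)

theorem ae_hasDerivAt_of_sub_eq_integral {h h' : ℝ → ℂ} (hi : Integrable h' volume)
    (hh : ∀ a b : ℝ, h b - h a = ∫ x in a..b, h' x) : ∀ᵐ x, HasDerivAt h (h' x) x := by
  have : h = fun x => h 0 + ∫ y in (0 : ℝ)..x, h' y := by
    funext x; rw [← hh 0 x]; ring
  filter_upwards [LocallyIntegrable.ae_hasDerivAt_integral hi.locallyIntegrable] with x hx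
  rw [this]
  exact (hx 0).const_add _

theorem absolutelyContinuousOnInterval_const (c : ℂ) (a b : ℝ) :
    AbsolutelyContinuousOnInterval (fun _ : ℝ => c) a b :=
  (contDiff_const.contDiffOn (n := 1)).absolutelyContinuousOnInterval

theorem absolutelyContinuousOnInterval_of_sub_eq_integral {h h' : ℝ → ℂ}
    (hi : Integrable h' volume)
    (hh : ∀ a b : ℝ, h b - h a = ∫ x in a..b, h' x) (a b : ℝ) :
    AbsolutelyContinuousOnInterval h a b := by
  have hre := (hi.re.intervalIntegrable (a := a) (b := b)
    ).absolutelyContinuousOnInterval_intervalIntegral (c := a) (by simp)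
  have him := (hi.im.intervalIntegrable (a := a) (b := b)
    ).absolutelyContinuousOnInterval_intervalIntegral (c := a) (by simp)
  have key := ((absolutelyContinuousOnInterval_const (h a) a b).fun_add
    (hre.fun_smul (absolutelyContinuousOnInterval_const 1 a b))).fun_add
    (him.fun_smul (absolutelyContinuousOnInterval_const Complex.I a b))
  convert! key using 1
  funext x
  have hx : h x = h a + ∫ y in a..x, h' y := by rw [← hh a x]; ring
  have hix : IntervalIntegrable h' volume a x := hi.intervalIntegrable
  have e1 : ∫ y in a..x, (RCLike.re (h' y) : ℝ) = (∫ y in a..x, h' y).re :=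
    Complex.reCLM.intervalIntegral_comp_comm hix
  have e2 : ∫ y in a..x, (RCLike.im (h' y) : ℝ) = (∫ y in a..x, h' y).im :=
    Complex.imCLM.intervalIntegral_comp_comm hix
  rw [e1, e2, hx]
  simp only [Complex.real_smul, mul_one, add_assoc, Complex.re_add_im]

/-- The product rule, in integrated form, for a primitive of an integrable function and a `C¹`
function. -/
theorem mul_sub_mul_eq_integral {h h' φ : ℝ → ℂ} (hi : Integrable h' volume)
    (hh : ∀ a b : ℝ, h b - h a = ∫ x in a..b, h' x) (hφ : ContDiff ℝ 1 φ)
    (hint : Integrable (fun x => h' x * φ x + h x * deriv φ x) volume) (a b : ℝ) :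
    h b * φ b - h a * φ a = ∫ x in a..b, (h' x * φ x + h x * deriv φ x) := by
  set g := fun x => h' x * φ x + h x * deriv φ x with hg
  set G : ℝ → ℂ := fun x => ∫ y in a..x, g y with hG
  have hGsub : ∀ c d : ℝ, G d - G c = ∫ x in c..d, g x := fun c d => by
    simp only [hG]
    exact intervalIntegral.integral_interval_sub_left hint.intervalIntegrable
      hint.intervalIntegrable
  have hac := ((absolutelyContinuousOnInterval_of_sub_eq_integral hi hh a b).fun_smul
    (hφ.contDiffOn.absolutelyContinuousOnInterval (a := a) (b := b))).fun_sub
    (absolutelyContinuousOnInterval_of_sub_eq_integral hint hGsub a b)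
  obtain ⟨C, hC⟩ := hac.const_of_ae_hasDerivAt_zero (by
    filter_upwards [ae_hasDerivAt_of_sub_eq_integral hi hh,
      ae_hasDerivAt_of_sub_eq_integral hint hGsub] with x h1 h2 _
    have h3 := (h1.mul (hφ.differentiable one_ne_zero x).hasDerivAt).sub h2
    simpa [hg] using! h3)
  have ha := hC a (by simp)
  have hb := hC b (by simp)
  have hGa : G a = 0 := by simp [hG]
  simp only [smul_eq_mul, hGa, sub_zero] at ha hb
  rw [ha, ← hb]
  ring

theorem integral_eq_zero_of_sub_eq_integral {K : Set ℝ} (hK : IsCompact K) {h h' : ℝ → ℂ}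
    (hi : Integrable h' volume) (h0 : ∀ x ∉ K, h x = 0)
    (hh : ∀ a b : ℝ, h b - h a = ∫ x in a..b, h' x) : ∫ x, h' x = 0 := by
  have lim := intervalIntegral_tendsto_integral hi
    (Filter.tendsto_neg_atTop_atBot (G := ℝ)) (Filter.tendsto_id (α := ℝ) (x := Filter.atTop))
  refine tendsto_nhds_unique lim (tendsto_const_nhds.congr' ?_)
  obtain ⟨R, hR⟩ := hK.isBounded.subset_closedBall 0
  filter_upwards [Filter.eventually_gt_atTop R, Filter.eventually_gt_atTop 0] with r hr hr0
  have hn : ∀ x : ℝ, |x| = r → h x = 0 := fun x hx => h0 x fun hxK => by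
    have := hR hxK
    rw [Metric.mem_closedBall, dist_zero_right, Real.norm_eq_abs] at this
    linarith
  rw [← hh, id, hn r (abs_of_pos hr0), hn (-r) (by rw [abs_neg, abs_of_pos hr0]), sub_zero]

namespace SobolevOn

variable {K : Set ℝ}

theorem integrable_and_ae_eq_zero (hK : IsCompact K) :
    ∀ {j : ℕ} {h : ℝ → ℂ}, SobolevOn K j h →
      Integrable h volume ∧ ∀ᵐ x, x ∉ K → h x = 0
  | 0, _, H => H
  | j + 1, h, ⟨h0, h', H', hh⟩ => by
    have hc := continuous_of_sub_eq_integral (integrable_and_ae_eq_zero hK H').1 hh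
    exact ⟨hc.integrable_of_hasCompactSupport (HasCompactSupport.intro hK h0),
      Filter.Eventually.of_forall h0⟩

theorem integrable_mul (hK : IsCompact K) {j : ℕ} {h φ : ℝ → ℂ} (H : SobolevOn K j h)
    (hφ : Continuous φ) : Integrable (fun x => h x * φ x) volume := by
  obtain ⟨hi, h0⟩ := H.integrable_and_ae_eq_zero hK
  refine (hi.integrableOn.mul_continuousOn hφ.continuousOn hK).integrable_of_ae_notMem_eq_zero ?_
  filter_upwards [h0] with x hx hxK
  simp [hx hxK]

theorem of_succ (hK : IsCompact K) :
    ∀ {j : ℕ} {h : ℝ → ℂ}, SobolevOn K (j + 1) h → SobolevOn K j h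
  | 0, _, H => H.integrable_and_ae_eq_zero hK
  | _ + 1, _, ⟨h0, h', H', hh⟩ => ⟨h0, h', of_succ hK H', hh⟩

theorem add (hK : IsCompact K) : ∀ {j : ℕ} {g h : ℝ → ℂ}, SobolevOn K j g → SobolevOn K j h →
    SobolevOn K j (fun x => g x + h x)
  | 0, _, _, ⟨gi, g0⟩, ⟨hi, h0⟩ => ⟨gi.add hi, by
      filter_upwards [g0, h0] with x hg hh hx
      rw [hg hx, hh hx, add_zero]⟩
  | _ + 1, g, h, ⟨g0, g', G', hg⟩, ⟨h0, h', H', hh⟩ =>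
    ⟨fun x hx => by simp [g0 x hx, h0 x hx], _, add hK G' H', fun a b => by
      rw [intervalIntegral.integral_add
        (G'.integrable_and_ae_eq_zero hK).1.intervalIntegrable
        (H'.integrable_and_ae_eq_zero hK).1.intervalIntegrable, ← hg, ← hh]
      ring⟩

theorem mul_contDiff (hK : IsCompact K) : ∀ {j : ℕ} {h φ : ℝ → ℂ}, SobolevOn K j h →
    ContDiff ℝ j φ → SobolevOn K j (fun x => h x * φ x)
  | 0, _, _, H, hφ => ⟨H.integrable_mul hK hφ.continuous, by
      filter_upwards [H.2] with x hx hxK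
      simp [hx hxK]⟩
  | j + 1, h, φ, H, hφ => by
    obtain ⟨h0, h', H', hh⟩ := id H
    have hφ' : ContDiff ℝ j (deriv φ) := by
      have : ContDiff ℝ ((j : WithTop ℕ∞) + 1) φ := by exact_mod_cast hφ
      exact (contDiff_succ_iff_deriv.1 this).2.2
    have hsum := (H'.mul_contDiff hK (hφ.of_le (by exact_mod_cast Nat.le_succ j))).add hK
      ((H.of_succ hK).mul_contDiff hK hφ')
    exact ⟨fun x hx => by simp [h0 x hx], _, hsum,
      mul_sub_mul_eq_integral (H'.integrable_and_ae_eq_zero hK).1 hh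
        (hφ.of_le (by exact_mod_cast Nat.le_add_left 1 j))
        (hsum.integrable_and_ae_eq_zero hK).1⟩

end SobolevOn

/-- Repeated integration by parts: decay of the Cauchy kernel powers against a non-stationary
oscillatory function, uniformly in the evaluation point. -/
theorem SobolevOn.exists_norm_integral_le {K : Set ℝ} (hK : IsCompact K) {θ : ℝ → ℝ}
    (hθ : ContDiff ℝ 1 θ) {n : ℕ} {ψ : ℝ → ℂ} (hψ : ContDiff ℝ n ψ)
    (hψθ : ∀ x ∈ K, ψ x * ((deriv θ x : ℝ) : ℂ) = 1) {R : ℝ} (hR : 0 ≤ R) :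
    ∀ {j : ℕ}, j ≤ n → ∀ {h : ℝ → ℂ}, SobolevOn K j h → ∀ m : ℕ,
      ∃ C : ℝ, 0 ≤ C ∧ ∀ t : ℝ, 1 ≤ t → ∀ z : ℂ, z.im ≠ 0 → ∀ r : ℝ, 0 ≤ r → r ≤ R →
        (∀ x ∈ K, ‖((x : ℂ) - z)⁻¹‖ ≤ r) →
        ‖∫ x : ℝ, h x * (Complex.exp (Complex.I * t * θ x) * ((x : ℂ) - z)⁻¹ ^ (m + 1))‖
          ≤ C * t⁻¹ ^ j * r := by
  have hne : ∀ z : ℂ, z.im ≠ 0 → ∀ x : ℝ, (x : ℂ) - z ≠ 0 := fun z hz x h0 => hz <| by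
    have := congrArg Complex.im h0
    simpa using this
  have hexp : ∀ t : ℝ, ContDiff ℝ 1 fun x : ℝ => Complex.exp (Complex.I * t * θ x) := fun t =>
    (contDiff_const.mul (Complex.ofRealCLM.contDiff.comp hθ)).cexp
  have hker : ∀ z : ℂ, z.im ≠ 0 → ∀ m : ℕ,
      ContDiff ℝ 1 fun x : ℝ => ((x : ℂ) - z)⁻¹ ^ m := fun z hz m =>
    ((Complex.ofRealCLM.contDiff.sub contDiff_const).inv (hne z hz)).pow m
  intro j
  induction j with
  | zero =>
    intro _ h H m
    obtain ⟨hi, h0⟩ := H.integrable_and_ae_eq_zero hK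
    refine ⟨(∫ x, ‖h x‖) * R ^ m, by positivity, fun t _ z hz r hr hrR hzr => ?_⟩
    have hle : ∀ᵐ x : ℝ, ‖h x * (Complex.exp (Complex.I * t * θ x) *
        ((x : ℂ) - z)⁻¹ ^ (m + 1))‖ ≤ ‖h x‖ * (R ^ m * r) := by
      filter_upwards [h0] with x hx
      by_cases hxK : x ∈ K
      · have he : ‖Complex.exp (Complex.I * t * θ x)‖ = 1 := by
          rw [show Complex.I * t * θ x = ((t * θ x : ℝ) : ℂ) * Complex.I by push_cast; ring]
          exact Complex.norm_exp_ofReal_mul_I _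
        rw [norm_mul, norm_mul, he, one_mul, norm_pow, pow_succ]
        have := hzr x hxK
        gcongr
        exact this.trans hrR
      · simp [hx hxK]
    refine (norm_integral_le_of_norm_le (hi.norm.mul_const _) hle).trans_eq ?_
    rw [integral_mul_const]
    ring
  | succ j ih =>
    intro hj h H m
    obtain ⟨g0, g', G', hg⟩ := H.mul_contDiff hK (hψ.of_le (by exact_mod_cast hj))
    have G := (H.mul_contDiff hK (hψ.of_le (by exact_mod_cast hj))).of_succ hK
    set g := fun x => h x * ψ x with hgdef
    obtain ⟨C₁, hC₁, b₁⟩ := ih (by lia) G' m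
    obtain ⟨C₂, hC₂, b₂⟩ := ih (by lia) G (m + 1)
    refine ⟨C₁ + (m + 1) * C₂, by positivity, fun t ht z hz r hr hrR hzr => ?_⟩
    specialize b₁ t ht z hz r hr hrR hzr
    specialize b₂ t ht z hz r hr hrR hzr
    set E : ℝ → ℂ := fun x => Complex.exp (Complex.I * t * θ x)
    set φ : ℝ → ℂ := fun x => E x * ((x : ℂ) - z)⁻¹ ^ (m + 1) with hφ
    set χ : ℝ → ℂ := fun x => E x * ((x : ℂ) - z)⁻¹ ^ (m + 1 + 1) with hχ
    have hφc : ContDiff ℝ 1 φ := (hexp t).mul (hker z hz _)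
    have hχc : ContDiff ℝ 1 χ := (hexp t).mul (hker z hz _)
    have hderiv : ∀ x, deriv φ x =
        Complex.I * t * ((deriv θ x : ℝ) : ℂ) * φ x - (m + 1) * χ x := fun x => by
      have d1 : HasDerivAt E (E x * (Complex.I * t * ((deriv θ x : ℝ) : ℂ))) x :=
        (((hθ.differentiable one_ne_zero x).hasDerivAt.ofReal_comp).const_mul _).cexp
      have d2 := ((((hasDerivAt_id x).ofReal_comp).sub_const z).inv (hne z hz x)).pow (m + 1)
      have d3 := (d1.mul d2).deriv
      refine d3.trans ?_
      simp only [hφ, hχ, id, Pi.inv_apply, Pi.pow_apply]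
      push_cast
      rw [div_eq_mul_inv, ← inv_pow]
      generalize ((x : ℂ) - z)⁻¹ = w
      ring
    have hgθ : ∀ x, g x * ((deriv θ x : ℝ) : ℂ) = h x := fun x => by
      by_cases hx : x ∈ K
      · rw [hgdef, mul_assoc, hψθ x hx, mul_one]
      · rw [g0 x hx, H.1 x hx, zero_mul]
    have i₁ := G'.integrable_mul hK hφc.continuous
    have i₂ := G.integrable_mul hK hχc.continuous
    have i₃ := H.integrable_mul hK hφc.continuous
    have heq : (fun x => g' x * φ x + g x * deriv φ x) =
        fun x => (g' x * φ x + Complex.I * t * (h x * φ x)) - (m + 1) * (g x * χ x) := by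
      funext x
      rw [hderiv, ← hgθ x]
      ring
    have hint : Integrable (fun x => g' x * φ x + g x * deriv φ x) volume := by
      rw [heq]
      exact (i₁.add (i₃.const_mul _)).sub (i₂.const_mul _)
    have hzero := integral_eq_zero_of_sub_eq_integral hK (h := fun x => g x * φ x) hint
      (fun x hx => by rw [g0 x hx, zero_mul])
      (mul_sub_mul_eq_integral (G'.integrable_and_ae_eq_zero hK).1 hg hφc hint)
    rw [heq, integral_sub (by exact i₁.add (i₃.const_mul _)) (i₂.const_mul _),
      integral_add i₁ (i₃.const_mul _), integral_const_mul, integral_const_mul] at hzero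
    have ht0 : 0 < t := by linarith
    have hmul : Complex.I * t * ∫ x, h x * φ x =
        -(∫ x, g' x * φ x) + (m + 1) * ∫ x, g x * χ x := by
      linear_combination hzero
    have hnorm := congrArg norm hmul
    rw [norm_mul, norm_mul, Complex.norm_I, one_mul, Complex.norm_real,
      Real.norm_of_nonneg ht0.le] at hnorm
    have hm : ‖(m + 1 : ℂ)‖ = m + 1 := by
      exact_mod_cast Complex.norm_natCast (m + 1)
    have hbd : t * ‖∫ x, h x * φ x‖ ≤ (C₁ + (m + 1) * C₂) * t⁻¹ ^ j * r := by
      rw [hnorm]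
      refine (norm_add_le _ _).trans ?_
      rw [norm_neg, norm_mul, hm]
      calc _ ≤ C₁ * t⁻¹ ^ j * r + (m + 1) * (C₂ * t⁻¹ ^ j * r) := by gcongr
        _ = _ := by ring
    calc ‖∫ x, h x * φ x‖ = t⁻¹ * (t * ‖∫ x, h x * φ x‖) := by field_simp
      _ ≤ t⁻¹ * ((C₁ + (m + 1) * C₂) * t⁻¹ ^ j * r) := by gcongr
      _ = _ := by ring

open scoped Manifold ContDiff in
/-- A function that is `C^n` on an open set agrees near a closed subset with a global `C^n`
function. -/
theorem ContDiffOn.exists_contDiff_eq_nhdsSet {V K : Set ℝ} (hV : IsOpen V) (hK : IsClosed K)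
    (hKV : K ⊆ V) {n : ℕ} {g : ℝ → ℝ} (hg : ContDiffOn ℝ n g V) :
    ∃ G : ℝ → ℝ, ContDiff ℝ n G ∧ ∀ᶠ x in nhdsSet K, G x = g x := by
  obtain ⟨χ, h0, h1, -⟩ := exists_contMDiffMap_zero_one_nhds_of_isClosed 𝓘(ℝ, ℝ) (n := (⊤ : ℕ∞))
    hV.isClosed_compl hK (disjoint_compl_left_iff_subset.2 hKV)
  have hχ : ContDiff ℝ n χ := χ.contMDiff.contDiff.of_le (by exact_mod_cast le_top)
  refine ⟨fun x => χ x * g x, contDiff_iff_contDiffAt.2 fun x => ?_, ?_⟩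
  · by_cases hx : x ∈ V
    · exact hχ.contDiffAt.mul (hg.contDiffAt (hV.mem_nhds hx))
    · have : (fun x => χ x * g x) =ᶠ[nhds x] fun _ => 0 := by
        filter_upwards [h0.filter_mono (nhds_le_nhdsSet hx)] with y hy
        rw [hy, zero_mul]
      exact contDiffAt_const.congr_of_eventuallyEq this
  · filter_upwards [h1] with x hx
    rw [hx, one_mul]

theorem contDiffOn_of_hasDerivAt_family {U : Set ℝ} (hU : IsOpen U) {N : ℕ} {Θ : ℕ → ℝ → ℝ}
    (hθ : ∀ n < N, ∀ x ∈ U, HasDerivAt (Θ n) (Θ (n + 1) x) x) (hθc : ContinuousOn (Θ N) U) :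
    ∀ {j i : ℕ}, i + j = N → ContDiffOn ℝ j (Θ i) U := by
  intro j
  induction j with
  | zero =>
    intro i hi
    obtain rfl : i = N := by lia
    exact contDiffOn_zero.2 hθc
  | succ j ih =>
    intro i hi
    have hd := hθ i (by lia)
    have : ContDiffOn ℝ ((j : WithTop ℕ∞) + 1) (Θ i) U :=
      (contDiffOn_succ_iff_deriv_of_isOpen hU).2
        ⟨fun x hx => (hd x hx).differentiableAt.differentiableWithinAt, by simp,
          (ih (i := i + 1) (by lia)).congr fun x hx => (hd x hx).deriv⟩
    exact_mod_cast this

theorem sobolevOn_of_hasDerivAt_family {k : ℕ} (hk : 1 ≤ k) {f : ℝ → ℂ} {Df : ℕ → ℝ → ℂ}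
    (hDf0 : Df 0 = f)
    (hf : ∀ i < k - 1, ∀ x : ℝ, HasDerivAt (Df i) (Df (i + 1) x) x)
    (hfc : Continuous (Df (k - 1)))
    (hftc : ∀ a b : ℝ, Df (k - 1) b - Df (k - 1) a = ∫ x in a..b, Df k x)
    (hfk : Integrable (Df k) volume) : SobolevOn (tsupport f) k f := by
  have hopen : IsOpen (tsupport f)ᶜ := (isClosed_tsupport f).isOpen_compl
  have hzero : ∀ i ≤ k - 1, ∀ x ∉ tsupport f, Df i x = 0 := by
    intro i
    induction i with
    | zero => exact fun _ x hx => hDf0 ▸ image_eq_zero_of_notMem_tsupport hx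
    | succ i ih =>
      intro hi x hx
      have : Df i =ᶠ[nhds x] fun _ => 0 := by
        filter_upwards [hopen.mem_nhds hx] with y hy using ih (by lia) y hy
      exact (hf i (by lia) x).unique ((hasDerivAt_const x 0).congr_of_eventuallyEq this)
  have hcont : ∀ i ≤ k - 1, Continuous (Df i) := fun i hi => by
    rcases hi.eq_or_lt with rfl | hlt
    · exact hfc
    · exact continuous_iff_continuousAt.2 fun x => (hf i hlt x).continuousAt
  have main : ∀ j i : ℕ, i + j = k → SobolevOn (tsupport f) j (Df i) := by
    intro j
    induction j with
    | zero =>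
      intro i hi
      obtain rfl : i = k := by lia
      refine ⟨hfk, ?_⟩
      filter_upwards [ae_hasDerivAt_of_sub_eq_integral hfk hftc] with x hx hxK
      have : Df (i - 1) =ᶠ[nhds x] fun _ => 0 := by
        filter_upwards [hopen.mem_nhds hxK] with y hy using hzero _ le_rfl y hy
      exact hx.unique ((hasDerivAt_const x 0).congr_of_eventuallyEq this)
    | succ j ih =>
      intro i hi
      refine ⟨hzero i (by lia), Df (i + 1), ih (i + 1) (by lia), fun a b => ?_⟩
      rcases Nat.eq_zero_or_pos j with rfl | hj
      · obtain rfl : i + 1 = k := by lia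
        exact hftc a b
      · exact (intervalIntegral.integral_eq_sub_of_hasDerivAt (fun x _ => hf i (by lia) x)
          ((hcont (i + 1) (by lia)).intervalIntegrable a b)).symm
  exact hDf0 ▸ main k 0 (by lia)

theorem sin_mul_le_norm_sub_ray {α d s y : ℝ} (hd : 0 < d) (hy : d ≤ |y|) :
    |Real.sin α| * (s + d) / 2 ≤ ‖(y : ℂ) - s * Complex.exp (α * Complex.I)‖ := by
  refine le_of_sq_le_sq ?_ (norm_nonneg _)
  have hy2 : d ^ 2 ≤ y ^ 2 := by
    rw [← sq_abs y]
    gcongr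
  have hre : ((y : ℂ) - s * Complex.exp (α * Complex.I)).re = y - s * Real.cos α := by
    simp [Complex.exp_ofReal_mul_I_re]
  have him : ((y : ℂ) - s * Complex.exp (α * Complex.I)).im = -(s * Real.sin α) := by
    simp [Complex.exp_ofReal_mul_I_im]
  rw [Complex.sq_norm, Complex.normSq_apply, hre, him, div_pow, mul_pow, sq_abs]
  have h1 := Real.sin_sq_add_cos_sq α
  have h2 : Real.sin α ^ 2 * y ^ 2 ≤ y ^ 2 - 2 * y * s * Real.cos α + s ^ 2 := by
    nlinarith [sq_nonneg (y * Real.cos α - s)]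
  have h3 : Real.sin α ^ 2 * s ^ 2 ≤ y ^ 2 - 2 * y * s * Real.cos α + s ^ 2 := by
    nlinarith [sq_nonneg (y - s * Real.cos α)]
  have h4 : Real.sin α ^ 2 * (s + d) ^ 2 ≤ Real.sin α ^ 2 * (2 * s ^ 2 + 2 * y ^ 2) := by
    gcongr
    nlinarith [sq_nonneg (s - d)]
  have h5 : s ^ 2 * (Real.sin α ^ 2 + Real.cos α ^ 2) = s ^ 2 := by rw [h1, mul_one]
  nlinarith

theorem memLp_inv_add_Ioi {p : ENNReal} (hp : 1 < p) {d : ℝ} (hd : 0 < d) :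
    MemLp (fun s : ℝ => (s + d)⁻¹) p (volume.restrict (Ioi 0)) := by
  have hm : AEStronglyMeasurable (fun s : ℝ => (s + d)⁻¹) (volume.restrict (Ioi 0)) :=
    (by fun_prop : Measurable fun s : ℝ => (s + d)⁻¹).aestronglyMeasurable
  rcases eq_or_ne p ⊤ with rfl | hpt
  · refine memLp_top_of_bound hm d⁻¹ ?_
    filter_upwards [ae_restrict_mem measurableSet_Ioi] with s (hs : 0 < s)
    rw [Real.norm_of_nonneg (by positivity)]
    gcongr
    linarith
  · have hp1 : 1 < p.toReal := by
      rwa [← ENNReal.toReal_one, ENNReal.toReal_lt_toReal ENNReal.one_ne_top hpt]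
    refine (integrable_norm_rpow_iff hm (by positivity) hpt).1 ?_
    refine (integrableOn_add_rpow_Ioi_of_lt (a := -p.toReal) (c := 0) (m := d)
      (by linarith) (by linarith)).congr ?_
    filter_upwards [ae_restrict_mem measurableSet_Ioi] with s (hs : 0 < s)
    have : 0 < s + d := by positivity
    rw [Real.norm_of_nonneg (by positivity), Real.inv_rpow this.le, Real.rpow_neg this.le]

/-- Cauchy transform along a ray of a non-stationary oscillatory function: if `f` is
compactly supported and `(k−1)`-times continuously differentiable with `f^{(k−1)}` locally
absolutely continuous and `f^{(k)} ∈ L¹` (the derivative family `Df`, `Df 0 = f`, encodes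
this), `θ` is `(k+1)`-times continuously differentiable on an open neighborhood `U` of
`supp f` (derivative family `Θ`, `Θ 0 = θ`) with `θ' ≠ 0` on `supp f`, and
`dist(supp f, λ₀) ≥ d`, then the `L^p` norm (arclength) on the ray
`Γ = {λ₀ + s e^{iα} : s > 0}` of `λ ↦ (1/(2πi)) ∫ f e^{itθ}/(x − λ) dx` is `≤ C t^{−k}`
for `t ≥ 1`, where `C` may depend on `k, p, α, d, f, θ` but not on `t`. -/
theorem stmt12 (k : ℕ) (hk : 1 ≤ k) (p : ENNReal) (hp : 1 < p)
    (α : ℝ) (hα : α ∈ Set.Ioo 0 Real.pi ∪ Set.Ioo Real.pi (2 * Real.pi))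
    (lam0 : ℝ) (d : ℝ) (hd : 0 < d)
    (f : ℝ → ℂ) (Df : ℕ → ℝ → ℂ) (hDf0 : Df 0 = f)
    (hf : ∀ i < k - 1, ∀ x : ℝ, HasDerivAt (Df i) (Df (i + 1) x) x)
    (hfc : Continuous (Df (k - 1)))
    (hftc : ∀ a b : ℝ, Df (k - 1) b - Df (k - 1) a = ∫ x in a..b, Df k x)
    (hfk : Integrable (Df k) volume)
    (hcs : HasCompactSupport f)
    (U : Set ℝ) (hU : IsOpen U) (hUsupp : tsupport f ⊆ U)
    (θ : ℝ → ℝ) (Θ : ℕ → ℝ → ℝ) (hΘ0 : Θ 0 = θ)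
    (hθ : ∀ n < k + 1, ∀ x ∈ U, HasDerivAt (Θ n) (Θ (n + 1) x) x)
    (hθc : ContinuousOn (Θ (k + 1)) U)
    (hθ' : ∀ x ∈ tsupport f, Θ 1 x ≠ 0)
    (hdist : ∀ x ∈ tsupport f, d ≤ |x - lam0|) :
    ∃ C : ℝ, 0 < C ∧
      ∀ t : ℝ, 1 ≤ t →
        eLpNorm
            (fun s : ℝ =>
              (1 / (2 * (Real.pi : ℂ) * Complex.I)) *
                ∫ x : ℝ,
                  f x * Complex.exp (Complex.I * (t : ℂ) * ((θ x : ℝ) : ℂ)) /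
                    ((x : ℂ) - ((lam0 : ℂ) + (s : ℂ) * Complex.exp ((α : ℂ) * Complex.I))))
            p (volume.restrict (Set.Ioi 0))
          ≤ ENNReal.ofReal (C * t ^ (-(k : ℝ))) := by
  have hK : IsCompact (tsupport f) := hcs
  have hKc : IsClosed (tsupport f) := isClosed_tsupport f
  have hW := sobolevOn_of_hasDerivAt_family hk hDf0 hf hfc hftc hfk
  have hΘ : ContDiffOn ℝ ((k + 1 : ℕ) : WithTop ℕ∞) θ U :=
    hΘ0 ▸ contDiffOn_of_hasDerivAt_family hU hθ hθc (zero_add _)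
  have hΘ1 : ContDiffOn ℝ k (Θ 1) U := contDiffOn_of_hasDerivAt_family hU hθ hθc (add_comm 1 k)
  obtain ⟨τ, hτ, hτθ⟩ := hΘ.exists_contDiff_eq_nhdsSet hU hKc hUsupp
  have hV : IsOpen (U ∩ Θ 1 ⁻¹' {0}ᶜ) :=
    hΘ1.continuousOn.isOpen_inter_preimage hU isOpen_compl_singleton
  obtain ⟨ψ, hψ, hψθ⟩ := ContDiffOn.exists_contDiff_eq_nhdsSet hV hKc
    (fun x hx => ⟨hUsupp hx, hθ' x hx⟩)
    ((hΘ1.mono inter_subset_left).inv fun x hx => hx.2)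
  have hτ' : ∀ x ∈ tsupport f, deriv τ x = Θ 1 x := fun x hx => by
    have he : τ =ᶠ[nhds x] θ := hτθ.filter_mono (nhds_le_nhdsSet hx)
    rw [he.deriv_eq, ← hΘ0]
    exact (hθ 0 (by lia) x (hUsupp hx)).deriv
  have hσ : 0 < |Real.sin α| := abs_pos.2 fun h0 => by
    rcases hα with ⟨h1, h2⟩ | ⟨h1, h2⟩
    · exact (Real.sin_pos_of_pos_of_lt_pi h1 h2).ne' h0
    · have := Real.sin_pos_of_pos_of_lt_pi (x := α - Real.pi) (by linarith) (by linarith)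
      rw [Real.sin_sub_pi] at this
      linarith
  obtain ⟨A, hA, hbound⟩ := hW.exists_norm_integral_le hK
    (hτ.of_le (by exact_mod_cast Nat.le_add_left 1 k)) (ψ := fun x => (ψ x : ℂ))
    (Complex.ofRealCLM.contDiff.comp hψ)
    (fun x hx => by
      have hx1 := (hψθ.filter_mono (nhds_le_nhdsSet hx)).self_of_nhds
      rw [hτ' x hx, hx1, Pi.inv_apply, ← Complex.ofReal_mul, inv_mul_cancel₀ (hθ' x hx), Complex.ofReal_one])
    (R := 2 / |Real.sin α| * d⁻¹) (by positivity) le_rfl 0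
  have hmem := memLp_inv_add_Ioi hp hd
  set N := (eLpNorm (fun s : ℝ => (s + d)⁻¹) p (volume.restrict (Ioi 0))).toReal
  set B := ‖1 / (2 * (Real.pi : ℂ) * Complex.I)‖ * A * (2 / |Real.sin α|) with hB
  have hB0 : 0 ≤ B := by positivity
  refine ⟨B * N + 1, by positivity, fun t ht => ?_⟩
  have ht0 : 0 < t := by linarith
  have hpt : ∀ᵐ s : ℝ ∂volume.restrict (Ioi (0 : ℝ)),
      ‖(1 / (2 * (Real.pi : ℂ) * Complex.I)) * ∫ x : ℝ,
        f x * Complex.exp (Complex.I * (t : ℂ) * ((θ x : ℝ) : ℂ)) /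
          ((x : ℂ) - ((lam0 : ℂ) + (s : ℂ) * Complex.exp ((α : ℂ) * Complex.I)))‖ ≤
      ((B * t⁻¹ ^ k) • fun s : ℝ => (s + d)⁻¹) s := by
    filter_upwards [ae_restrict_mem measurableSet_Ioi] with s (hs : 0 < s)
    set z := (lam0 : ℂ) + (s : ℂ) * Complex.exp ((α : ℂ) * Complex.I) with hz
    have hzim : z.im ≠ 0 := by
      have : z.im = s * Real.sin α := by simp [hz, Complex.exp_ofReal_mul_I_im]
      rw [this]
      exact mul_ne_zero hs.ne' (abs_pos.1 hσ)
    have hsd : 0 < s + d := by positivity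
    have hker : ∀ x ∈ tsupport f, ‖((x : ℂ) - z)⁻¹‖ ≤ 2 / |Real.sin α| * (s + d)⁻¹ :=
      fun x hx => by
      have h1 := sin_mul_le_norm_sub_ray (α := α) (s := s) hd (hdist x hx)
      have h2 : ((x - lam0 : ℝ) : ℂ) - s * Complex.exp (α * Complex.I) = x - z := by
        rw [hz]
        push_cast
        ring
      rw [h2] at h1
      calc ‖((x : ℂ) - z)⁻¹‖ = ‖(x : ℂ) - z‖⁻¹ := norm_inv _
        _ ≤ (|Real.sin α| * (s + d) / 2)⁻¹ := by gcongr
        _ = _ := by field_simp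
    have hle : 2 / |Real.sin α| * (s + d)⁻¹ ≤ 2 / |Real.sin α| * d⁻¹ := by
      gcongr
      linarith
    have hb := hbound t ht z hzim _ (by positivity) hle hker
    have heq : (fun x : ℝ => f x * Complex.exp (Complex.I * (t : ℂ) * ((θ x : ℝ) : ℂ)) /
        ((x : ℂ) - z)) = fun x : ℝ => f x *
          (Complex.exp (Complex.I * t * τ x) * ((x : ℂ) - z)⁻¹ ^ (0 + 1)) := by
      funext x
      by_cases hx : x ∈ tsupport f
      · have hx1 := (hτθ.filter_mono (nhds_le_nhdsSet hx)).self_of_nhds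
        rw [hx1, zero_add, pow_one, div_eq_mul_inv, mul_assoc]
      · simp [image_eq_zero_of_notMem_tsupport hx]
    rw [heq, norm_mul]
    calc _ ≤ ‖1 / (2 * (Real.pi : ℂ) * Complex.I)‖ *
          (A * t⁻¹ ^ k * (2 / |Real.sin α| * (s + d)⁻¹)) := by gcongr
      _ = _ := by
        rw [hB, Pi.smul_apply, smul_eq_mul]
        ring
  refine (eLpNorm_mono_ae_real hpt).trans ?_
  have hc : 0 ≤ B * t⁻¹ ^ k := by positivity
  rw [eLpNorm_const_smul, Real.enorm_of_nonneg hc, ← ENNReal.ofReal_toReal hmem.eLpNorm_ne_top,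
    ← ENNReal.ofReal_mul hc]
  refine ENNReal.ofReal_le_ofReal ?_
  rw [Real.rpow_neg ht0.le, Real.rpow_natCast, ← inv_pow]
  have : 0 ≤ t⁻¹ ^ k := by positivity
  linarith [show B * t⁻¹ ^ k * N = B * N * t⁻¹ ^ k by ring]
end

section
/- Let k ≥ 1 be an integer and q ∈ [1, ∞] with kq > 1. Let U ⊂ ℝ be open, let θ : ℝ → ℝ be (k+1)-times continuously differentiable on U with θ'(x) > 0 for all x ∈ U, and let f : ℝ → ℂ be (k−1)-times continuously differentiable with f^{(k−1)} locally absolutely continuous and with compact support contained in U. Then there is a constant C, depending only on k and q, such that for every t > 0, the L^q norm over ξ ∈ [0, ∞) of ξ ↦ ∫_ℝ f(x) e^{i(xξ + tθ(x))} dx is at most C · t^{−(k − 1/q)} · ∫_ℝ |θ'(x)|^{1/q} f_{θ,k}(x) dx (where for q = ∞ the L^q norm is the essential supremum and |θ'|^{1/q} is interpreted as 1). -/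
open MeasureTheory Set

/-- The finite set of tuples `(α₁, …, α_k)` of nonnegative integers with
`α₁ + 2α₂ + ⋯ + kα_k = k − β` (each `αᵢ ≤ k` automatically, so the range `k+1` is no
restriction). -/
def tupleSet (k β : ℕ) : Finset (Fin k → ℕ) :=
  (Fintype.piFinset fun _ : Fin k => Finset.range (k + 1)).filter
    (fun a => (∑ i : Fin k, ((i : ℕ) + 1) * a i) = k - β)

/-- The phase-dependent weight
`w_{k,β}(θ)(x) = Σ_α |θ'(x)|^{−(k+α₁+⋯+α_k)} |θ''(x)|^{α₁} ⋯ |θ^{(k+1)}(x)|^{α_k}`,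
expressed through the derivative family `Θ` (`Θ n` is the `n`-th derivative of `θ`). -/
noncomputable def wWeight (Θ : ℕ → ℝ → ℝ) (k β : ℕ) (x : ℝ) : ℝ :=
  ∑ a ∈ tupleSet k β,
    |Θ 1 x| ^ (-((k : ℝ) + ∑ i : Fin k, (a i : ℝ))) *
      ∏ i : Fin k, |Θ ((i : ℕ) + 2) x| ^ (a i)

/-- The weighted sum of derivatives `f_{θ,k}(x) = Σ_{β=0}^{k} |f^{(β)}(x)| w_{k,β}(θ)(x)`,
expressed through the derivative families `Df` and `Θ`. -/
noncomputable def fWeighted (Df : ℕ → ℝ → ℂ) (Θ : ℕ → ℝ → ℝ) (k : ℕ) (x : ℝ) : ℝ :=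
  ∑ β ∈ Finset.range (k + 1), ‖Df β x‖ * wWeight Θ k β x

theorem MeasureTheory.LocallyIntegrable.absolutelyContinuousOnInterval_intervalIntegral_complex
    {g : ℝ → ℂ} (hg : LocallyIntegrable g volume) (a b : ℝ) :
    AbsolutelyContinuousOnInterval (fun x => ∫ v in a..x, g v) a b := by
  have hgi (x : ℝ) : IntervalIntegrable g volume a x :=
    intervalIntegrable_iff.mpr <|
      (hg.integrableOn_isCompact isCompact_uIcc).mono_set uIoc_subset_uIcc
  have hre : IntervalIntegrable (fun x => (g x).re) volume a b := ⟨(hgi b).1.re, (hgi b).2.re⟩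
  have him : IntervalIntegrable (fun x => (g x).im) volume a b := ⟨(hgi b).1.im, (hgi b).2.im⟩
  have hc (c : ℂ) : AbsolutelyContinuousOnInterval (fun _ : ℝ => c) a b :=
    contDiffOn_const.absolutelyContinuousOnInterval
  have h := ((hre.absolutelyContinuousOnInterval_intervalIntegral left_mem_uIcc).smul (hc 1)).add
    ((him.absolutelyContinuousOnInterval_intervalIntegral left_mem_uIcc).smul (hc Complex.I))
  have heq : (fun x => ∫ v in a..x, g v) =
      (((fun x => ∫ v in a..x, (g v).re) • fun _ => (1 : ℂ)) +
        ((fun x => ∫ v in a..x, (g v).im) • fun _ => Complex.I)) := by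
    funext x
    apply Complex.ext
    · simpa using (Complex.reCLM.intervalIntegral_comp_comm (hgi x)).symm
    · simpa using (Complex.imCLM.intervalIntegral_comp_comm (hgi x)).symm
  rwa [heq]

theorem contDiff_mul_of_tsupport_subset {U : Set ℝ} (hU : IsOpen U) {χ : ℝ → ℝ} {G : ℝ → ℂ}
    (hχ : ContDiff ℝ 1 χ) (hχU : tsupport χ ⊆ U) (hG : ContDiffOn ℝ 1 G U) :
    ContDiff ℝ 1 (fun x => (χ x : ℂ) * G x) := by
  rw [contDiff_iff_contDiffAt]
  intro x
  by_cases hx : x ∈ tsupport χ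
  · exact (Complex.ofRealCLM.contDiff.contDiffAt.comp x hχ.contDiffAt).mul
      (hG.contDiffAt (hU.mem_nhds (hχU hx)))
  · refine (contDiffAt_const (c := (0 : ℂ))).congr_of_eventuallyEq ?_
    filter_upwards [notMem_tsupport_iff_eventuallyEq.1 hx] with y hy
    simp [hy]

open Manifold in
theorem exists_contDiff_eq_one_nhds {K U : Set ℝ} (hK : IsClosed K) (hU : IsOpen U) (hKU : K ⊆ U) :
    ∃ χ : ℝ → ℝ, ContDiff ℝ 1 χ ∧ tsupport χ ⊆ U ∧ ∀ x ∈ K, ∀ᶠ y in nhds x, χ y = 1 := by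
  obtain ⟨χ, h0, h1, -⟩ := exists_contMDiffMap_zero_one_nhds_of_isClosed (n := 1) 𝓘(ℝ, ℝ)
    hU.isClosed_compl hK (disjoint_compl_left_iff_subset.2 hKU)
  refine ⟨χ, χ.contMDiff.contDiff, fun x hx => ?_, fun x hx => ?_⟩
  · by_contra hxU
    exact (notMem_tsupport_iff_eventuallyEq.2 (eventually_nhdsSet_iff_forall.1 h0 x hxU)) hx
  · exact eventually_nhdsSet_iff_forall.1 h1 x hx

/-- Integration by parts on an interval for a `C¹` factor and a primitive. -/
theorem intervalIntegral_primitive_mul_deriv {F F' H : ℝ → ℂ} (a b : ℝ)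
    (hF' : LocallyIntegrable F' volume) (hFF' : ∀ a b : ℝ, F b - F a = ∫ x in a..b, F' x)
    (hFc : Continuous F) (hH : ContDiff ℝ 1 H) :
    ∫ x in a..b, (F' x * H x + F x * deriv H x) = F b * H b - F a * H a := by
  have hFeq : F = (fun _ => F a) + fun x => ∫ v in a..x, F' v := by
    funext x
    simp [← hFF']
  have hFac : AbsolutelyContinuousOnInterval F a b := by
    rw [hFeq]
    exact contDiffOn_const.absolutelyContinuousOnInterval.add
      (hF'.absolutelyContinuousOnInterval_intervalIntegral_complex a b)
  have hHac : AbsolutelyContinuousOnInterval H a b :=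
    hH.contDiffOn.absolutelyContinuousOnInterval
  have hdHc : Continuous (deriv H) := hH.continuous_deriv le_rfl
  have hli : LocallyIntegrable (fun x => F' x * H x + F x * deriv H x) volume := by
    refine LocallyIntegrable.add ?_ (hFc.mul hdHc).locallyIntegrable
    rw [← locallyIntegrableOn_univ] at hF' ⊢
    exact hF'.mul_continuousOn hH.continuous.continuousOn isOpen_univ.isLocallyClosed
  have hac := (hFac.smul hHac).sub
    (hli.absolutelyContinuousOnInterval_intervalIntegral_complex a b)
  obtain ⟨C, hC⟩ := hac.const_of_ae_hasDerivAt_zero (by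
    filter_upwards [_root_.LocallyIntegrable.ae_hasDerivAt_integral hF',
      _root_.LocallyIntegrable.ae_hasDerivAt_integral hli] with x h1 h2 _
    have h3 : HasDerivAt F (F' x) x := by
      rw [hFeq]
      exact (h1 a).const_add _
    have h4 := (h3.mul (hH.differentiable one_ne_zero x).hasDerivAt).sub (h2 a)
    rw [sub_self] at h4
    exact h4)
  have ha := hC a left_mem_uIcc
  have hb := hC b right_mem_uIcc
  simp only [Pi.sub_apply, Pi.mul_apply, smul_eq_mul, intervalIntegral.integral_same,
    sub_zero] at ha hb
  rw [ha, ← hb]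
  ring

theorem ae_eq_zero_of_notMem_tsupport_primitive {F F' : ℝ → ℂ}
    (hF' : LocallyIntegrable F' volume) (hFF' : ∀ a b : ℝ, F b - F a = ∫ x in a..b, F' x) :
    ∀ᵐ x, x ∉ tsupport F → F' x = 0 := by
  filter_upwards [_root_.LocallyIntegrable.ae_hasDerivAt_integral hF'] with x h hx
  have h1 : HasDerivAt F (F' x) x := by
    have := (h 0).const_add (F 0)
    simpa [← hFF'] using this
  have h2 : HasDerivAt F 0 x :=
    (hasDerivAt_const x (0 : ℂ)).congr_of_eventuallyEq (notMem_tsupport_iff_eventuallyEq.1 hx)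
  exact h1.unique h2

theorem integrable_mul_of_ae_eq_zero {F G : ℝ → ℂ} {K U : Set ℝ}
    (hF : LocallyIntegrable F volume) (hK : IsCompact K) (hKU : K ⊆ U)
    (hFK : ∀ᵐ x, x ∉ K → F x = 0) (hG : ContinuousOn G U) :
    Integrable (fun x => F x * G x) := by
  have h : IntegrableOn (fun x => F x * G x) K :=
    (hF.integrableOn_isCompact hK).mul_continuousOn (hG.mono hKU) hK
  refine h.integrable_of_ae_notMem_eq_zero ?_
  filter_upwards [hFK] with x hx hxK
  simp [hx hxK]

/-- Integration by parts on the line, the `C¹` factor being defined on an open set that contains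
the compact support of the primitive. -/
theorem integral_primitive_mul_hasDerivAt {F F' G G' : ℝ → ℂ} {U : Set ℝ} (hU : IsOpen U)
    (hF' : LocallyIntegrable F' volume) (hFF' : ∀ a b : ℝ, F b - F a = ∫ x in a..b, F' x)
    (hFc : Continuous F) (hFs : HasCompactSupport F) (hFU : tsupport F ⊆ U)
    (hG : ∀ x ∈ U, HasDerivAt G (G' x) x) (hG' : ContinuousOn G' U) :
    ∫ x, F x * G' x = - ∫ x, F' x * G x := by
  obtain ⟨χ, hχ, hχU, hχ1⟩ := exists_contDiff_eq_one_nhds (isClosed_tsupport F) hU hFU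
  have hGd : ContDiffOn ℝ 1 G U := by
    rw [show (1 : WithTop ℕ∞) = 0 + 1 from rfl, contDiffOn_succ_iff_deriv_of_isOpen hU]
    refine ⟨fun x hx => (hG x hx).differentiableAt.differentiableWithinAt, by simp, ?_⟩
    exact contDiffOn_zero.2 (hG'.congr fun x hx => (hG x hx).deriv)
  have hH := contDiff_mul_of_tsupport_subset hU hχ hχU hGd
  set H : ℝ → ℂ := fun x => (χ x : ℂ) * G x with hHdef
  have hz := ae_eq_zero_of_notMem_tsupport_primitive hF' hFF'
  have hGc : ContinuousOn G U := fun x hx => (hG x hx).continuousAt.continuousWithinAt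
  have h1 : ∀ x, F x * deriv H x = F x * G' x := by
    intro x
    by_cases hx : x ∈ tsupport F
    · congr 1
      refine HasDerivAt.deriv ((hG x (hFU hx)).congr_of_eventuallyEq ?_)
      filter_upwards [hχ1 x hx] with y hy
      simp [hHdef, hy]
    · simp [image_eq_zero_of_notMem_tsupport hx]
  have h2 : ∀ᵐ x, F' x * H x = F' x * G x := by
    filter_upwards [hz] with x hx
    by_cases hxs : x ∈ tsupport F
    · simp [hHdef, (hχ1 x hxs).self_of_nhds]
    · simp [hx hxs]
  have hi1 : Integrable (fun x => F' x * G x) :=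
    integrable_mul_of_ae_eq_zero hF' hFs hFU hz hGc
  have hi2 : Integrable (fun x => F x * G' x) :=
    integrable_mul_of_ae_eq_zero hFc.locallyIntegrable hFs hFU
      (ae_of_all _ fun x hx => image_eq_zero_of_notMem_tsupport hx) hG'
  obtain ⟨R, hR0, hR⟩ := hFs.isCompact.isBounded.subset_ball_lt 0 0
  have hR' : ∀ x, x ∉ Ioc (-R) R → x ∉ tsupport F := by
    intro x hx hxs
    have := hR hxs
    rw [Real.ball_eq_Ioo] at this
    exact hx ⟨by linarith [this.1], by linarith [this.2]⟩
  have hRF : ∀ x, |R| ≤ |x| → F x = 0 := by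
    intro x hx
    refine image_eq_zero_of_notMem_tsupport fun hxs => ?_
    have := hR hxs
    rw [mem_ball_zero_iff, Real.norm_eq_abs] at this
    linarith [le_abs_self R]
  have hibp := intervalIntegral_primitive_mul_deriv (-R) R hF' hFF' hFc hH
  rw [hRF R le_rfl, hRF (-R) (by simp)] at hibp
  rw [intervalIntegral.integral_of_le (by linarith),
    setIntegral_eq_integral_of_ae_compl_eq_zero] at hibp
  · have : ∫ x, (F' x * H x + F x * deriv H x) = ∫ x, (F' x * G x + F x * G' x) := by
      refine integral_congr_ae ?_
      filter_upwards [h2] with x hx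
      rw [hx, h1]
    rw [this, integral_add hi1 hi2] at hibp
    linear_combination hibp
  · filter_upwards [hz] with x hx hxR
    rw [hx (hR' x hxR), image_eq_zero_of_notMem_tsupport (hR' x hxR)]
    simp

/-- The lists obtained from `l` by increasing one entry by one. -/
def incrementLists : List ℕ → List (List ℕ)
  | [] => []
  | a :: l => ((a + 1) :: l) :: (incrementLists l).map (a :: ·)

theorem mem_incrementLists {l l' : List ℕ} (h : l' ∈ incrementLists l) :
    l'.length = l.length ∧ l'.sum = l.sum + 1 ∧ ((∀ a ∈ l, 1 ≤ a) → ∀ a ∈ l', 1 ≤ a) := by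
  induction l generalizing l' with
  | nil => simp [incrementLists] at h
  | cons a l ih =>
    simp only [incrementLists, List.mem_cons, List.mem_map] at h
    rcases h with rfl | ⟨m, hm, rfl⟩
    · refine ⟨by simp, by simp; ring, fun h b hb => ?_⟩
      rcases List.mem_cons.1 hb with rfl | hb
      · omega
      · exact h b (by simp [hb])
    · obtain ⟨h1, h2, h3⟩ := ih hm
      refine ⟨by simp [h1], by simp [h2]; ring, fun h b hb => ?_⟩
      rcases List.mem_cons.1 hb with rfl | hb
      · exact h _ (by simp)
      · exact h3 (fun c hc => h c (by simp [hc])) b hb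

/-- The factor `(ξ + tθ')⁻ⁿ ∏ tθ⁽ᵃ⁺¹⁾`, the product running over the entries `a` of `l`. -/
noncomputable def phaseFactor (Θ : ℕ → ℝ → ℝ) (t ξ : ℝ) (n : ℕ) (l : List ℕ) (x : ℝ) : ℝ :=
  (ξ + t * Θ 1 x)⁻¹ ^ n * (l.map fun a => t * Θ (a + 1) x).prod

theorem hasDerivAt_list_prod_phase {Θ : ℕ → ℝ → ℝ} {t x : ℝ} {k : ℕ}
    (hΘ : ∀ n < k + 1, HasDerivAt (Θ n) (Θ (n + 1) x) x) {l : List ℕ} (hl : ∀ a ∈ l, a < k) :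
    HasDerivAt (fun y => (l.map fun a => t * Θ (a + 1) y).prod)
      ((incrementLists l).map fun l' => (l'.map fun a => t * Θ (a + 1) x).prod).sum x := by
  induction l with
  | nil => simpa [incrementLists] using hasDerivAt_const x (1 : ℝ)
  | cons a l ih =>
    have h1 := (hΘ (a + 1) (by have := hl a (by simp); omega)).const_mul t
    have h2 := h1.mul (ih fun b hb => hl b (by simp [hb]))
    simp only [incrementLists, List.map_cons, List.prod_cons, List.sum_cons, List.map_map,
      Function.comp_def, List.sum_map_mul_left]
    exact h2

theorem hasDerivAt_phaseFactor {Θ : ℕ → ℝ → ℝ} {t ξ x : ℝ} {k : ℕ} (hk : 1 ≤ k)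
    (hΘ : ∀ n < k + 1, HasDerivAt (Θ n) (Θ (n + 1) x) x) (hx : ξ + t * Θ 1 x ≠ 0) (n : ℕ)
    {l : List ℕ} (hl : ∀ a ∈ l, a < k) :
    HasDerivAt (phaseFactor Θ t ξ n l)
      (-(n : ℝ) * phaseFactor Θ t ξ (n + 1) (1 :: l) x +
        ((incrementLists l).map fun l' => phaseFactor Θ t ξ n l' x).sum) x := by
  have h1 : HasDerivAt (fun y => ξ + t * Θ 1 y) (t * Θ 2 x) x :=
    ((hΘ 1 (by omega)).const_mul t).const_add ξ
  have h2 := ((h1.inv hx).pow n).mul (hasDerivAt_list_prod_phase (t := t) hΘ hl)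
  refine h2.congr_deriv ?_
  simp only [phaseFactor, List.sum_map_mul_left, List.map_cons, List.prod_cons, Pi.pow_apply,
    Pi.inv_apply]
  rcases n with _ | n
  · simp
  · simp only [Nat.add_sub_cancel]
    have : -(t * Θ 2 x) / (ξ + t * Θ 1 x) ^ 2 = - (t * Θ 2 x) * (ξ + t * Θ 1 x)⁻¹ ^ 2 := by
      rw [inv_pow]; rfl
    rw [this]
    norm_num [-inv_pow]
    generalize (ξ + t * Θ 1 x)⁻¹ = p
    ring

theorem continuousOn_phaseFactor {Θ : ℕ → ℝ → ℝ} {U : Set ℝ} {t ξ : ℝ} {k : ℕ}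
    (hΘ : ∀ n ≤ k + 1, ContinuousOn (Θ n) U) (hx : ∀ x ∈ U, ξ + t * Θ 1 x ≠ 0) (n : ℕ)
    {l : List ℕ} (hl : ∀ a ∈ l, a ≤ k) :
    ContinuousOn (phaseFactor Θ t ξ n l) U := by
  unfold phaseFactor
  refine ContinuousOn.mul (((continuousOn_const.add
    (continuousOn_const.mul (hΘ 1 (by omega)))).inv₀ hx).pow n) ?_
  refine continuousOn_list_prod l fun a ha => ?_
  exact continuousOn_const.mul (hΘ (a + 1) (by have := hl a ha; omega))

@[to_additive]
theorem prod_pow_count_eq_prod_map {M : Type*} [CommMonoid M] (g : ℕ → M) {k : ℕ} {l : List ℕ}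
    (hl : ∀ a ∈ l, 1 ≤ a ∧ a ≤ k) :
    ∏ i : Fin k, g ((i : ℕ) + 1) ^ l.count ((i : ℕ) + 1) = (l.map g).prod := by
  induction l with
  | nil => simp
  | cons a l ih =>
    obtain ⟨h1, h2⟩ := hl a (by simp)
    rw [List.map_cons, List.prod_cons, ← ih fun b hb => hl b (by simp [hb])]
    simp only [List.count_cons, pow_add, Finset.prod_mul_distrib]
    rw [mul_comm]
    congr 1
    rw [Finset.prod_eq_single (⟨a - 1, by omega⟩ : Fin k)]
    · simp [Nat.sub_add_cancel h1]
    · intro b _ hb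
      have : a ≠ b + 1 := fun h => hb (Fin.ext (by simp [h]))
      simp [this]
    · simp

theorem le_wWeight {Θ : ℕ → ℝ → ℝ} {k β : ℕ} {l : List ℕ} (hl : ∀ a ∈ l, 1 ≤ a)
    (hβ : β + l.sum = k) (x : ℝ) :
    |Θ 1 x| ^ (-((k : ℝ) + (l.length : ℝ))) * (l.map fun a => |Θ (a + 1) x|).prod
      ≤ wWeight Θ k β x := by
  have hlk : ∀ a ∈ l, 1 ≤ a ∧ a ≤ k := fun a ha =>
    ⟨hl a ha, (List.single_le_sum (fun _ _ => Nat.zero_le _) a ha).trans (by omega)⟩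
  have hcount : ∑ i : Fin k, l.count ((i : ℕ) + 1) = l.length := by
    have := sum_nsmul_count_eq_sum_map (fun _ => 1) hlk
    simpa using this
  have hsum : ∑ i : Fin k, ((i : ℕ) + 1) * l.count ((i : ℕ) + 1) = l.sum := by
    have := sum_nsmul_count_eq_sum_map (fun a => a) hlk
    simpa [mul_comm] using this
  have hlen : l.length ≤ l.sum := List.length_le_sum_of_one_le l hl
  have hmem : (fun i : Fin k => l.count ((i : ℕ) + 1)) ∈ tupleSet k β := by
    simp only [tupleSet, Finset.mem_filter, Fintype.mem_piFinset, Finset.mem_range]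
    refine ⟨fun i => ?_, by omega⟩
    have := List.count_le_length (a := (i : ℕ) + 1) (l := l)
    omega
  refine le_trans (le_of_eq ?_) (Finset.single_le_sum (f := fun a : Fin k → ℕ =>
    |Θ 1 x| ^ (-((k : ℝ) + ∑ i : Fin k, (a i : ℝ))) *
      ∏ i : Fin k, |Θ ((i : ℕ) + 2) x| ^ (a i)) (fun a _ => by positivity) hmem)
  have hprod := prod_pow_count_eq_prod_map (fun a => |Θ (a + 1) x|) hlk
  simp only [← hcount, ← hprod]
  push_cast
  rfl

theorem wWeight_nonneg (Θ : ℕ → ℝ → ℝ) (k β : ℕ) (x : ℝ) : 0 ≤ wWeight Θ k β x :=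
  Finset.sum_nonneg fun _ _ => by positivity

theorem fWeighted_nonneg (Df : ℕ → ℝ → ℂ) (Θ : ℕ → ℝ → ℝ) (k : ℕ) (x : ℝ) :
    0 ≤ fWeighted Df Θ k x :=
  Finset.sum_nonneg fun _ _ => mul_nonneg (norm_nonneg _) (wWeight_nonneg _ _ _ _)

theorem abs_list_prod_mul (t : ℝ) (ht : 0 ≤ t) (g : ℕ → ℝ) (l : List ℕ) :
    |(l.map fun a => t * g a).prod| = t ^ l.length * (l.map fun a => |g a|).prod := by
  induction l with
  | nil => simp
  | cons a l ih =>
    simp only [List.map_cons, List.prod_cons, abs_mul, ih, abs_of_nonneg ht, List.length_cons]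
    ring

theorem abs_phaseFactor_le {Θ : ℕ → ℝ → ℝ} {t ξ x : ℝ} {k β : ℕ} (ht : 0 < t) (hξ : 0 ≤ ξ)
    (hx : 0 < Θ 1 x) {l : List ℕ} (hl : ∀ a ∈ l, 1 ≤ a) (hβ : β + l.sum = k) :
    |phaseFactor Θ t ξ (k + l.length) l x| ≤
      (ξ + t * Θ 1 x)⁻¹ ^ k * Θ 1 x ^ k * wWeight Θ k β x := by
  have hp : 0 < ξ + t * Θ 1 x := by positivity
  have hprod : 0 ≤ (l.map fun a => |Θ (a + 1) x|).prod :=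
    List.prod_nonneg fun a ha => by
      obtain ⟨b, -, rfl⟩ := List.mem_map.1 ha
      exact abs_nonneg _
  have hpow : |Θ 1 x| ^ (-((k : ℝ) + (l.length : ℝ))) = (Θ 1 x)⁻¹ ^ k * (Θ 1 x)⁻¹ ^ l.length := by
    rw [abs_of_pos hx, Real.rpow_neg hx.le, ← Nat.cast_add, Real.rpow_natCast, pow_add, mul_inv,
      inv_pow, inv_pow]
  have hle : (ξ + t * Θ 1 x)⁻¹ * t ≤ (Θ 1 x)⁻¹ := by
    rw [inv_mul_le_iff₀ hp, ← div_eq_mul_inv, le_div_iff₀ hx]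
    linarith
  calc |phaseFactor Θ t ξ (k + l.length) l x|
      = (ξ + t * Θ 1 x)⁻¹ ^ k * ((ξ + t * Θ 1 x)⁻¹ * t) ^ l.length *
          (l.map fun a => |Θ (a + 1) x|).prod := by
        rw [phaseFactor, abs_mul, abs_list_prod_mul t ht.le (fun a => Θ (a + 1) x), abs_pow,
          abs_inv, abs_of_pos hp]
        ring
    _ ≤ (ξ + t * Θ 1 x)⁻¹ ^ k * (Θ 1 x)⁻¹ ^ l.length *
          (l.map fun a => |Θ (a + 1) x|).prod := by gcongr
    _ = (ξ + t * Θ 1 x)⁻¹ ^ k * Θ 1 x ^ k * (|Θ 1 x| ^ (-((k : ℝ) + (l.length : ℝ))) *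
          (l.map fun a => |Θ (a + 1) x|).prod) := by
        rw [hpow]
        have : Θ 1 x ^ k * (Θ 1 x)⁻¹ ^ k = 1 := by rw [← mul_pow, mul_inv_cancel₀ hx.ne', one_pow]
        linear_combination (-(ξ + t * Θ 1 x)⁻¹ ^ k * (Θ 1 x)⁻¹ ^ l.length *
          (l.map fun a => |Θ (a + 1) x|).prod) * this
    _ ≤ _ := by
        gcongr
        exact le_wWeight hl hβ x

/-- The regularity of the phase and of the amplitude, with the primitive relation between
consecutive derivatives of the amplitude. -/
structure IsPhaseAmplitude (k : ℕ) (U K : Set ℝ) (Θ : ℕ → ℝ → ℝ) (Df : ℕ → ℝ → ℂ) : Prop where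
  isOpen : IsOpen U
  isCompact : IsCompact K
  subset : K ⊆ U
  hasDerivAt : ∀ n < k + 1, ∀ x ∈ U, HasDerivAt (Θ n) (Θ (n + 1) x) x
  continuousOn : ∀ n ≤ k + 1, ContinuousOn (Θ n) U
  pos : ∀ x ∈ U, 0 < Θ 1 x
  continuous : ∀ β < k, Continuous (Df β)
  sub_eq : ∀ β < k, ∀ a b : ℝ, Df β b - Df β a = ∫ x in a..b, Df (β + 1) x
  tsupport_subset : ∀ β < k, tsupport (Df β) ⊆ K
  locallyIntegrable_top : LocallyIntegrable (Df k) volume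

namespace IsPhaseAmplitude

variable {k : ℕ} {U K : Set ℝ} {Θ : ℕ → ℝ → ℝ} {Df : ℕ → ℝ → ℂ}

theorem locallyIntegrable (h : IsPhaseAmplitude k U K Θ Df) {β : ℕ} (hβ : β ≤ k) :
    LocallyIntegrable (Df β) volume := by
  rcases hβ.lt_or_eq with hlt | rfl
  · exact (h.continuous β hlt).locallyIntegrable
  · exact h.locallyIntegrable_top

theorem ae_eq_zero (h : IsPhaseAmplitude k U K Θ Df) (hk : 1 ≤ k) {β : ℕ} (hβ : β ≤ k) :
    ∀ᵐ x, x ∉ K → Df β x = 0 := by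
  rcases hβ.lt_or_eq with hlt | rfl
  · exact ae_of_all _ fun x hx =>
      image_eq_zero_of_notMem_tsupport fun hx' => hx (h.tsupport_subset β hlt hx')
  · obtain ⟨m, rfl⟩ : ∃ m, β = m + 1 := ⟨β - 1, by omega⟩
    filter_upwards [ae_eq_zero_of_notMem_tsupport_primitive h.locallyIntegrable_top
      (h.sub_eq m (by omega))] with x hx hxK
    exact hx fun hx' => hxK (h.tsupport_subset m (by omega) hx')

end IsPhaseAmplitude

/-- The oscillating factor `e^{i(xξ + tθ(x))}`. -/
noncomputable def phaseExp (θ : ℝ → ℝ) (t ξ x : ℝ) : ℂ :=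
  Complex.exp (Complex.I * (((x * ξ : ℝ) : ℂ) + (t : ℂ) * ((θ x : ℝ) : ℂ)))

theorem norm_phaseExp (θ : ℝ → ℝ) (t ξ x : ℝ) : ‖phaseExp θ t ξ x‖ = 1 := by
  rw [phaseExp, mul_comm, ← Complex.ofReal_mul, ← Complex.ofReal_add,
    Complex.norm_exp_ofReal_mul_I]

theorem hasDerivAt_phaseExp {θ : ℝ → ℝ} {θ' t ξ x : ℝ} (h : HasDerivAt θ θ' x) :
    HasDerivAt (phaseExp θ t ξ)
      (phaseExp θ t ξ x * (Complex.I * ((ξ + t * θ' : ℝ) : ℂ))) x := by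
  have h1 : HasDerivAt (fun y : ℝ => y * ξ + t * θ y) (ξ + t * θ') x := by
    have h0 := ((hasDerivAt_id x).mul_const ξ).add (h.const_mul t)
    rw [one_mul] at h0
    exact h0
  have h2 := ((h1.ofReal_comp).const_mul Complex.I).cexp
  have h3 : phaseExp θ t ξ =
      fun y => Complex.exp (Complex.I * ((y * ξ + t * θ y : ℝ) : ℂ)) := by
    funext y
    simp [phaseExp]
  rw [h3]
  exact h2

/-- The integral of `f^{(β)}` against a phase factor and the oscillating factor. -/
noncomputable def oscillatoryIntegral (Θ : ℕ → ℝ → ℝ) (Df : ℕ → ℝ → ℂ) (t ξ : ℝ) (n β : ℕ)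
    (l : List ℕ) : ℂ :=
  ∫ x, Df β x * ((phaseFactor Θ t ξ n l x : ℂ) * phaseExp (Θ 0) t ξ x)

namespace IsPhaseAmplitude

variable {k : ℕ} {U K : Set ℝ} {Θ : ℕ → ℝ → ℝ} {Df : ℕ → ℝ → ℂ} {t ξ : ℝ}

theorem phase_pos (h : IsPhaseAmplitude k U K Θ Df) (ht : 0 < t) (hξ : 0 ≤ ξ) {x : ℝ}
    (hx : x ∈ U) : 0 < ξ + t * Θ 1 x := by
  have := h.pos x hx
  positivity

theorem continuousOn_phaseFactor_mul (h : IsPhaseAmplitude k U K Θ Df) (ht : 0 < t) (hξ : 0 ≤ ξ)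
    (n : ℕ) {l : List ℕ} (hl : ∀ a ∈ l, a ≤ k) :
    ContinuousOn (fun x => (phaseFactor Θ t ξ n l x : ℂ) * phaseExp (Θ 0) t ξ x) U := by
  have h1 := continuousOn_phaseFactor h.continuousOn (fun x hx => (h.phase_pos ht hξ hx).ne') n hl
  have h2 : ContinuousOn (phaseExp (Θ 0) t ξ) U := fun x hx =>
    (hasDerivAt_phaseExp (h.hasDerivAt 0 (by omega) x hx)).continuousAt.continuousWithinAt
  exact (Complex.continuous_ofReal.comp_continuousOn h1).mul h2

theorem integrable (h : IsPhaseAmplitude k U K Θ Df) (hk : 1 ≤ k) (ht : 0 < t) (hξ : 0 ≤ ξ)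
    (n : ℕ) {β : ℕ} (hβ : β ≤ k) {l : List ℕ} (hl : ∀ a ∈ l, a ≤ k) :
    Integrable fun x => Df β x * ((phaseFactor Θ t ξ n l x : ℂ) * phaseExp (Θ 0) t ξ x) :=
  integrable_mul_of_ae_eq_zero (h.locallyIntegrable hβ) h.isCompact h.subset (h.ae_eq_zero hk hβ)
    (h.continuousOn_phaseFactor_mul ht hξ n hl)

theorem integral_list_sum (h : IsPhaseAmplitude k U K Θ Df) (hk : 1 ≤ k) (ht : 0 < t)
    (hξ : 0 ≤ ξ) (n : ℕ) {β : ℕ} (hβ : β ≤ k) {L : List (List ℕ)}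
    (hL : ∀ l ∈ L, ∀ a ∈ l, a ≤ k) :
    Integrable (fun x => Df β x *
      (((L.map fun l => phaseFactor Θ t ξ n l x).sum : ℝ) * phaseExp (Θ 0) t ξ x)) ∧
    ∫ x, Df β x * (((L.map fun l => phaseFactor Θ t ξ n l x).sum : ℝ) * phaseExp (Θ 0) t ξ x)
      = (L.map fun l => oscillatoryIntegral Θ Df t ξ n β l).sum := by
  induction L with
  | nil => simp
  | cons l L ih =>
    obtain ⟨h1, h2⟩ := ih fun m hm => hL m (by simp [hm])
    have h3 := h.integrable hk ht hξ n hβ (hL l (by simp))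
    simp only [List.map_cons, List.sum_cons, Complex.ofReal_add, add_mul, mul_add]
    exact ⟨h3.add h1, by rw [integral_add h3 h1, h2, oscillatoryIntegral]⟩

/-- One integration by parts against the oscillating factor. -/
theorem oscillatoryIntegral_eq (h : IsPhaseAmplitude k U K Θ Df) (hk : 1 ≤ k) (ht : 0 < t)
    (hξ : 0 ≤ ξ) (n : ℕ) {β : ℕ} (hβ : β < k) {l : List ℕ} (hl : l.sum < k) :
    oscillatoryIntegral Θ Df t ξ n β l = Complex.I *
      (oscillatoryIntegral Θ Df t ξ (n + 1) (β + 1) l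
        - ((n + 1 : ℕ) : ℂ) * oscillatoryIntegral Θ Df t ξ (n + 2) β (1 :: l)
        + ((incrementLists l).map fun l' => oscillatoryIntegral Θ Df t ξ (n + 1) β l').sum) := by
  have hlk : ∀ a ∈ l, a < k := fun a ha =>
    (List.single_le_sum (fun _ _ => Nat.zero_le _) a ha).trans_lt hl
  have hl1 : ∀ a ∈ 1 :: l, a ≤ k := by
    intro a ha
    rcases List.mem_cons.1 ha with rfl | ha
    · exact hk
    · exact (hlk a ha).le
  have hinc : ∀ l' ∈ incrementLists l, ∀ a ∈ l', a ≤ k := fun l' hl' a ha =>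
    (List.single_le_sum (fun _ _ => Nat.zero_le _) a ha).trans
      (by rw [(mem_incrementLists hl').2.1]; omega)
  have hderiv : ∀ x ∈ U, HasDerivAt
      (fun x => (phaseFactor Θ t ξ (n + 1) l x : ℂ) * phaseExp (Θ 0) t ξ x)
      (-((n + 1 : ℕ) : ℂ) * ((phaseFactor Θ t ξ (n + 2) (1 :: l) x : ℂ) * phaseExp (Θ 0) t ξ x)
        + (((incrementLists l).map fun l' => phaseFactor Θ t ξ (n + 1) l' x).sum : ℝ) *
            phaseExp (Θ 0) t ξ x
        + Complex.I * ((phaseFactor Θ t ξ n l x : ℂ) * phaseExp (Θ 0) t ξ x)) x := by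
    intro x hx
    have hp := (h.phase_pos ht hξ hx).ne'
    have h1 := hasDerivAt_phaseFactor hk (fun m hm => h.hasDerivAt m hm x hx) hp (n + 1) hlk
    have h2 := hasDerivAt_phaseExp (t := t) (ξ := ξ) (h.hasDerivAt 0 (by omega) x hx)
    refine (h1.ofReal_comp.mul h2).congr_deriv ?_
    have h3 : phaseFactor Θ t ξ (n + 1) l x * (ξ + t * Θ 1 x) = phaseFactor Θ t ξ n l x := by
      simp only [phaseFactor, pow_succ]
      field_simp
    rw [← h3]
    push_cast
    ring
  have hcont : ContinuousOn (fun x =>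
      (-((n + 1 : ℕ) : ℂ) * ((phaseFactor Θ t ξ (n + 2) (1 :: l) x : ℂ) * phaseExp (Θ 0) t ξ x)
        + (((incrementLists l).map fun l' => phaseFactor Θ t ξ (n + 1) l' x).sum : ℝ) *
            phaseExp (Θ 0) t ξ x
        + Complex.I * ((phaseFactor Θ t ξ n l x : ℂ) * phaseExp (Θ 0) t ξ x))) U := by
    have hosc : ContinuousOn (phaseExp (Θ 0) t ξ) U := fun x hx =>
      (hasDerivAt_phaseExp (h.hasDerivAt 0 (by omega) x hx)).continuousAt.continuousWithinAt
    refine ((continuousOn_const.mul (h.continuousOn_phaseFactor_mul ht hξ _ hl1)).add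
      (ContinuousOn.mul ?_ hosc)).add
      (continuousOn_const.mul (h.continuousOn_phaseFactor_mul ht hξ _ fun a ha => (hlk a ha).le))
    refine Complex.continuous_ofReal.comp_continuousOn (continuousOn_list_sum _ fun l' hl' => ?_)
    exact continuousOn_phaseFactor h.continuousOn (fun x hx => (h.phase_pos ht hξ hx).ne') _
      (hinc l' hl')
  have hs := h.tsupport_subset β hβ
  have hibp := integral_primitive_mul_hasDerivAt h.isOpen (h.locallyIntegrable (by omega))
    (h.sub_eq β hβ) (h.continuous β hβ) (h.isCompact.of_isClosed_subset (isClosed_tsupport _) hs)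
    (hs.trans h.subset) hderiv hcont
  obtain ⟨hi2, he2⟩ := h.integral_list_sum hk ht hξ (n + 1) hβ.le hinc
  have hi1 := (h.integrable hk ht hξ (n + 2) hβ.le hl1).const_mul (-((n + 1 : ℕ) : ℂ))
  have hi3 := (h.integrable hk ht hξ n hβ.le fun a ha => (hlk a ha).le).const_mul Complex.I
  have hsplit : ∀ x, Df β x * (-((n + 1 : ℕ) : ℂ) *
        ((phaseFactor Θ t ξ (n + 2) (1 :: l) x : ℂ) * phaseExp (Θ 0) t ξ x)
        + (((incrementLists l).map fun l' => phaseFactor Θ t ξ (n + 1) l' x).sum : ℝ) *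
            phaseExp (Θ 0) t ξ x
        + Complex.I * ((phaseFactor Θ t ξ n l x : ℂ) * phaseExp (Θ 0) t ξ x)) =
      -((n + 1 : ℕ) : ℂ) * (Df β x *
          ((phaseFactor Θ t ξ (n + 2) (1 :: l) x : ℂ) * phaseExp (Θ 0) t ξ x))
        + Df β x * ((((incrementLists l).map fun l' => phaseFactor Θ t ξ (n + 1) l' x).sum : ℝ) *
            phaseExp (Θ 0) t ξ x)
        + Complex.I * (Df β x *
          ((phaseFactor Θ t ξ n l x : ℂ) * phaseExp (Θ 0) t ξ x)) := fun x => by ring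
  simp_rw [hsplit] at hibp
  have hi12 : Integrable fun x => -((n + 1 : ℕ) : ℂ) * (Df β x *
          ((phaseFactor Θ t ξ (n + 2) (1 :: l) x : ℂ) * phaseExp (Θ 0) t ξ x))
        + Df β x * ((((incrementLists l).map fun l' => phaseFactor Θ t ξ (n + 1) l' x).sum : ℝ) *
            phaseExp (Θ 0) t ξ x) := hi1.add hi2
  rw [integral_add hi12 hi3, integral_add hi1 hi2, integral_const_mul, integral_const_mul,
    he2] at hibp
  have hfold : ∀ (n β : ℕ) (l : List ℕ),
      ∫ x, Df β x * ((phaseFactor Θ t ξ n l x : ℂ) * phaseExp (Θ 0) t ξ x) =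
        oscillatoryIntegral Θ Df t ξ n β l := fun _ _ _ => rfl
  simp only [hfold] at hibp
  linear_combination (-Complex.I) * hibp + oscillatoryIntegral Θ Df t ξ n β l * Complex.I_sq

/-- The majorant of the oscillatory integrals of top order. -/
theorem enorm_oscillatoryIntegral_le_of_eq (h : IsPhaseAmplitude k U K Θ Df) (hk : 1 ≤ k)
    (ht : 0 < t) (hξ : 0 ≤ ξ) {β : ℕ} {l : List ℕ} (hl : ∀ a ∈ l, 1 ≤ a) (hβ : β + l.sum = k) :
    ‖oscillatoryIntegral Θ Df t ξ (k + l.length) β l‖ₑ ≤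
      ∫⁻ x in U, ENNReal.ofReal ((ξ + t * Θ 1 x)⁻¹ ^ k * (Θ 1 x ^ k * fWeighted Df Θ k x)) := by
  rw [oscillatoryIntegral, ← setIntegral_eq_integral_of_ae_compl_eq_zero (s := U)]
  swap
  · filter_upwards [h.ae_eq_zero hk (show β ≤ k by omega)] with x hx hxU
    rw [hx fun hxK => hxU (h.subset hxK), zero_mul]
  refine (enorm_integral_le_lintegral_enorm _).trans (setLIntegral_mono' h.isOpen.measurableSet ?_)
  intro x hx
  rw [← ofReal_norm]
  refine ENNReal.ofReal_le_ofReal ?_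
  rw [norm_mul, norm_mul, norm_phaseExp, mul_one, Complex.norm_real, Real.norm_eq_abs]
  have hp := h.phase_pos ht hξ hx
  have hpos := h.pos x hx
  have hle : ‖Df β x‖ * wWeight Θ k β x ≤ fWeighted Df Θ k x :=
    Finset.single_le_sum (f := fun β => ‖Df β x‖ * wWeight Θ k β x)
      (fun γ _ => mul_nonneg (norm_nonneg _) (wWeight_nonneg _ _ _ _))
      (Finset.mem_range.2 (by omega))
  calc ‖Df β x‖ * |phaseFactor Θ t ξ (k + l.length) l x|
      ≤ ‖Df β x‖ * ((ξ + t * Θ 1 x)⁻¹ ^ k * Θ 1 x ^ k * wWeight Θ k β x) := by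
        gcongr
        exact abs_phaseFactor_le ht hξ hpos hl hβ
    _ = (ξ + t * Θ 1 x)⁻¹ ^ k * (Θ 1 x ^ k * (‖Df β x‖ * wWeight Θ k β x)) := by ring
    _ ≤ _ := by gcongr

end IsPhaseAmplitude

theorem exists_enorm_oscillatoryIntegral_le {k : ℕ} (hk : 1 ≤ k) (m : ℕ) :
    ∀ (β : ℕ) (l : List ℕ), (∀ a ∈ l, 1 ≤ a) → β + l.sum + m = k →
      ∃ C : NNReal, ∀ (U K : Set ℝ) (Θ : ℕ → ℝ → ℝ) (Df : ℕ → ℝ → ℂ),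
        IsPhaseAmplitude k U K Θ Df → ∀ t ξ : ℝ, 0 < t → 0 ≤ ξ →
        ‖oscillatoryIntegral Θ Df t ξ (β + l.sum + l.length) β l‖ₑ ≤ C *
          ∫⁻ x in U, ENNReal.ofReal
            ((ξ + t * Θ 1 x)⁻¹ ^ k * (Θ 1 x ^ k * fWeighted Df Θ k x)) := by
  induction m with
  | zero =>
    intro β l hl hβ
    refine ⟨1, fun U K Θ Df h t ξ ht hξ => ?_⟩
    rw [add_zero] at hβ
    rw [hβ, ENNReal.coe_one, one_mul]
    exact h.enorm_oscillatoryIntegral_le_of_eq hk ht hξ hl hβ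
  | succ m ih =>
    intro β l hl hβ
    obtain ⟨C₁, h₁⟩ := ih (β + 1) l hl (by omega)
    obtain ⟨C₂, h₂⟩ := ih β (1 :: l) (by simpa using hl) (by simp; omega)
    have h₃ : ∀ L : List (List ℕ), (∀ l' ∈ L, l' ∈ incrementLists l) →
        ∃ C : NNReal, ∀ (U K : Set ℝ) (Θ : ℕ → ℝ → ℝ) (Df : ℕ → ℝ → ℂ),
        IsPhaseAmplitude k U K Θ Df → ∀ t ξ : ℝ, 0 < t → 0 ≤ ξ →
        ‖(L.map fun l' => oscillatoryIntegral Θ Df t ξ (β + l.sum + l.length + 1) β l').sum‖ₑ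
          ≤ C * ∫⁻ x in U, ENNReal.ofReal
            ((ξ + t * Θ 1 x)⁻¹ ^ k * (Θ 1 x ^ k * fWeighted Df Θ k x)) := by
      intro L hL
      induction L with
      | nil => exact ⟨0, by simp⟩
      | cons l' L ihL =>
        obtain ⟨C, hC⟩ := ihL fun l'' hl'' => hL l'' (by simp [hl''])
        obtain ⟨hlen, hsum, hone⟩ := mem_incrementLists (hL l' (by simp))
        obtain ⟨C', hC'⟩ := ih β l' (hone hl) (by omega)
        refine ⟨C' + C, fun U K Θ Df h t ξ ht hξ => ?_⟩
        have hn : β + l'.sum + l'.length = β + l.sum + l.length + 1 := by omega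
        have := hC' U K Θ Df h t ξ ht hξ
        rw [hn] at this
        rw [List.map_cons, List.sum_cons, ENNReal.coe_add, add_mul]
        exact (enorm_add_le _ _).trans (add_le_add this (hC U K Θ Df h t ξ ht hξ))
    obtain ⟨C₃, h₃⟩ := h₃ _ fun _ => id
    refine ⟨C₁ + (β + l.sum + l.length + 1 : ℕ) * C₂ + C₃, fun U K Θ Df h t ξ ht hξ => ?_⟩
    have h₁' := h₁ U K Θ Df h t ξ ht hξ
    have h₂' := h₂ U K Θ Df h t ξ ht hξ
    have h₃' := h₃ U K Θ Df h t ξ ht hξ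
    rw [show β + 1 + l.sum + l.length = β + l.sum + l.length + 1 by omega] at h₁'
    rw [show β + (1 :: l).sum + (1 :: l).length = β + l.sum + l.length + 2 by simp; omega] at h₂'
    rw [h.oscillatoryIntegral_eq hk ht hξ _ (by omega) (by omega), enorm_mul,
      ← ofReal_norm Complex.I, Complex.norm_I, ENNReal.ofReal_one, one_mul]
    refine (enorm_add_le _ _).trans ?_
    rw [ENNReal.coe_add, ENNReal.coe_add, add_mul, add_mul]
    refine add_le_add ((enorm_sub_le).trans (add_le_add h₁' ?_)) h₃'
    rw [enorm_mul, ENNReal.coe_mul, mul_assoc]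
    refine mul_le_mul' (le_of_eq ?_) h₂'
    rw [← ofReal_norm, Complex.norm_natCast, ENNReal.ofReal_natCast, ENNReal.coe_natCast]

/-- Minkowski's integral inequality for a kernel whose `L^p` norms are dominated by `m`. -/
theorem lintegral_lintegral_mul_rpow_le {α β : Type*} [MeasurableSpace α] [MeasurableSpace β]
    {μ : Measure α} {ν : Measure β} [SFinite μ] [SFinite ν] {p : ℝ} (hp : 1 ≤ p)
    {K : α → β → ENNReal} {m h : β → ENNReal}
    (hK : AEMeasurable (Function.uncurry K) (μ.prod ν)) (hK' : ∀ x, AEMeasurable (K x) ν)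
    (hK'' : ∀ y, AEMeasurable (fun x => K x y) μ)
    (hm : AEMeasurable m ν) (hh : AEMeasurable h ν) (hm0 : ∀ᵐ y ∂ν, m y ≠ 0 ∧ m y ≠ ⊤)
    (hKm : ∀ᵐ y ∂ν, ∫⁻ x, K x y ^ p ∂μ ≤ m y ^ p) :
    ∫⁻ x, (∫⁻ y, K x y * h y ∂ν) ^ p ∂μ ≤ (∫⁻ y, m y * h y ∂ν) ^ p := by
  have hp0 : 0 < p := by linarith
  set M := ∫⁻ y, m y * h y ∂ν with hM
  set g : α → β → ENNReal := fun x y => (K x y / m y) ^ p * (m y * h y) with hg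
  have hpt : ∀ x, (∫⁻ y, K x y * h y ∂ν) ^ p ≤ (∫⁻ y, g x y ∂ν) * M ^ (p - 1) := by
    intro x
    have h1 : ∫⁻ y, K x y * h y ∂ν ≤ (∫⁻ y, g x y ∂ν) ^ (1 / p) * M ^ (1 - 1 / p) := by
      refine le_trans (le_of_eq (lintegral_congr_ae ?_))
        (ENNReal.lintegral_mul_norm_pow_le (p := 1 / p) (q := 1 - 1 / p)
          ((((hK' x).div hm).pow_const p).mul (hm.mul hh)) (hm.mul hh) (by positivity)
          (by rw [sub_nonneg, div_le_one hp0]; exact hp) (by ring))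
      filter_upwards [hm0] with y hy
      simp only [Pi.mul_apply, Pi.div_apply]
      rw [ENNReal.mul_rpow_of_nonneg _ _ (by positivity), ← ENNReal.rpow_mul,
        mul_one_div_cancel hp0.ne', ENNReal.rpow_one, mul_assoc,
        ← ENNReal.rpow_add_of_nonneg _ _ (by positivity)
          (by rw [sub_nonneg, div_le_one hp0]; exact hp),
        add_sub_cancel, ENNReal.rpow_one, ← mul_assoc, ENNReal.div_mul_cancel hy.1 hy.2]
    calc (∫⁻ y, K x y * h y ∂ν) ^ p
        ≤ ((∫⁻ y, g x y ∂ν) ^ (1 / p) * M ^ (1 - 1 / p)) ^ p :=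
          ENNReal.rpow_le_rpow h1 hp0.le
      _ = (∫⁻ y, g x y ∂ν) * M ^ (p - 1) := by
          rw [ENNReal.mul_rpow_of_nonneg _ _ hp0.le, ← ENNReal.rpow_mul, ← ENNReal.rpow_mul,
            one_div_mul_cancel hp0.ne', ENNReal.rpow_one, sub_mul, one_mul,
            one_div_mul_cancel hp0.ne']
  have hsnd : Measure.QuasiMeasurePreserving Prod.snd (μ.prod ν) ν :=
    Measure.quasiMeasurePreserving_snd
  have hm2 : AEMeasurable (fun z : α × β => m z.2) (μ.prod ν) :=
    hm.comp_quasiMeasurePreserving hsnd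
  have hh2 : AEMeasurable (fun z : α × β => h z.2) (μ.prod ν) :=
    hh.comp_quasiMeasurePreserving hsnd
  have hgm : AEMeasurable (Function.uncurry g) (μ.prod ν) :=
    ((hK.div hm2).pow_const p).mul (hm2.mul hh2)
  have hinteg : ∫⁻ x, ∫⁻ y, g x y ∂ν ∂μ ≤ M := by
    rw [lintegral_lintegral_swap hgm]
    refine lintegral_mono_ae ?_
    filter_upwards [hm0, hKm] with y hy hKy
    have h2 : ∀ x, g x y = K x y ^ p * ((m y ^ p)⁻¹ * (m y * h y)) := by
      intro x
      simp only [hg]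
      rw [ENNReal.div_rpow_of_nonneg _ _ hp0.le, div_eq_mul_inv, mul_assoc]
    simp_rw [h2]
    rw [lintegral_mul_const'' _ ((hK'' y).pow_const p), ← mul_assoc, ← div_eq_mul_inv]
    refine mul_le_of_le_one_left' ?_
    exact ENNReal.div_le_of_le_mul (by rwa [one_mul])
  calc ∫⁻ x, (∫⁻ y, K x y * h y ∂ν) ^ p ∂μ
      ≤ ∫⁻ x, (∫⁻ y, g x y ∂ν) * M ^ (p - 1) ∂μ := lintegral_mono hpt
    _ = (∫⁻ x, ∫⁻ y, g x y ∂ν ∂μ) * M ^ (p - 1) :=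
        lintegral_mul_const'' _ hgm.lintegral_prod_right'
    _ ≤ M * M ^ (p - 1) := by gcongr
    _ = M ^ p := by
        nth_rw 1 [← ENNReal.rpow_one M]
        rw [← ENNReal.rpow_add_of_nonneg _ _ zero_le_one (by linarith), add_sub_cancel]

theorem lintegral_Ici_ofReal_add_rpow {a c : ℝ} (ha : 1 < a) (hc : 0 < c) :
    ∫⁻ ξ in Ici (0 : ℝ), ENNReal.ofReal ((ξ + c) ^ (-a)) =
      ENNReal.ofReal (c ^ (1 - a) / (a - 1)) := by
  rw [Measure.restrict_congr_set Ioi_ae_eq_Ici.symm]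
  have h := (measurePreserving_add_right volume c).setLIntegral_comp_preimage_emb
    (measurableEmbedding_addRight c) (fun x => ENNReal.ofReal (x ^ (-a))) (Ioi c)
  rw [Set.preimage_add_const_Ioi, sub_self] at h
  rw [h, ← ofReal_integral_eq_lintegral_ofReal (integrableOn_Ioi_rpow_of_lt (by linarith) hc),
    integral_Ioi_rpow_of_lt (by linarith) hc]
  · congr 1
    rw [show -a + 1 = -(a - 1) by ring, neg_div_neg_eq, show 1 - a = -(a - 1) by ring]
  · filter_upwards [self_mem_ae_restrict measurableSet_Ioi] with x hx
    exact Real.rpow_nonneg (hc.trans hx).le _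

theorem eLpNorm_le_of_enorm_le_lintegral {k : ℕ} {q : ENNReal} (hq : 1 ≤ q)
    (hkq : 1 < (k : ENNReal) * q) : ∃ c : ℝ, 0 < c ∧
    ∀ (U : Set ℝ) (g W : ℝ → ℝ) (F : ℝ → ℂ) (C : NNReal) (t : ℝ), MeasurableSet U → 0 < t →
      (∀ x ∈ U, 0 < g x) → (∀ x ∈ U, 0 ≤ W x) → AEMeasurable g (volume.restrict U) →
      AEMeasurable W (volume.restrict U) →
      (∀ ξ, 0 ≤ ξ → ‖F ξ‖ₑ ≤
        C * ∫⁻ x in U, ENNReal.ofReal ((ξ + t * g x)⁻¹ ^ k * (g x ^ k * W x))) →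
      eLpNorm F q (volume.restrict (Ici 0)) ≤
        C * (ENNReal.ofReal (c * t ^ (-((k : ℝ) - 1 / q.toReal))) *
          ∫⁻ x in U, ENNReal.ofReal (g x ^ (1 / q.toReal) * W x)) := by
  rcases eq_or_ne q ⊤ with rfl | hqtop
  · refine ⟨1, one_pos, fun U g W F C t hU ht hg hW hgm hWm hF => ?_⟩
    rw [eLpNorm_exponent_top]
    refine eLpNormEssSup_le_of_ae_enorm_bound ?_
    filter_upwards [self_mem_ae_restrict measurableSet_Ici] with ξ hξ
    refine (hF ξ hξ).trans ?_
    gcongr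
    rw [← lintegral_const_mul' _ _ ENNReal.ofReal_ne_top]
    refine setLIntegral_mono' hU fun x hx => ?_
    rw [← ENNReal.ofReal_mul (by positivity)]
    refine ENNReal.ofReal_le_ofReal ?_
    have hgx := hg x hx
    have hξ0 : (0 : ℝ) ≤ ξ := hξ
    have h1 : (ξ + t * g x)⁻¹ ≤ (t * g x)⁻¹ := inv_anti₀ (by positivity) (by linarith)
    calc (ξ + t * g x)⁻¹ ^ k * (g x ^ k * W x)
        ≤ (t * g x)⁻¹ ^ k * (g x ^ k * W x) := by
          have := hW x hx
          gcongr
      _ = 1 * t ^ (-((k : ℝ) - 1 / (⊤ : ENNReal).toReal)) *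
          (g x ^ (1 / (⊤ : ENNReal).toReal) * W x) := by
          rw [ENNReal.toReal_top, div_zero, sub_zero, Real.rpow_zero, Real.rpow_neg ht.le,
            Real.rpow_natCast, mul_inv, mul_pow, inv_pow, inv_pow]
          field_simp
  · set Q := q.toReal with hQ
    have hqQ : q = ENNReal.ofReal Q := (ENNReal.ofReal_toReal hqtop).symm
    have hQ1 : 1 ≤ Q := by
      rw [hQ, ← ENNReal.toReal_one]
      exact ENNReal.toReal_mono hqtop hq
    have hQ0 : 0 < Q := by linarith
    have hkQ : 1 < k * Q := by
      rw [hqQ, ← ENNReal.ofReal_natCast, ← ENNReal.ofReal_mul (by positivity),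
        ← ENNReal.ofReal_one, ENNReal.ofReal_lt_ofReal_iff_of_nonneg zero_le_one] at hkq
      exact hkq
    have hd : 0 < k * Q - 1 := by linarith
    refine ⟨(k * Q - 1) ^ (-(1 / Q)), by positivity,
      fun U g W F C t hU ht hg hW hgm hWm hF => ?_⟩
    set K : ℝ → ℝ → ENNReal := fun ξ x => ENNReal.ofReal ((ξ + t * g x)⁻¹ ^ k) with hK
    set m : ℝ → ENNReal := fun x =>
      ENNReal.ofReal ((k * Q - 1) ^ (-(1 / Q)) * (t * g x) ^ (-((k : ℝ) - 1 / Q))) with hm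
    set h : ℝ → ENNReal := fun x => ENNReal.ofReal (g x ^ k * W x) with hh
    have hU' : ∀ᵐ x ∂(volume.restrict U), x ∈ U := self_mem_ae_restrict hU
    have hmink := lintegral_lintegral_mul_rpow_le (μ := volume.restrict (Ici (0 : ℝ)))
      (ν := volume.restrict U) (K := K) (m := m) (h := h) hQ1 ?_ ?_ ?_ ?_ ?_ ?_ ?_
    · have hKh : ∀ ξ : ℝ, 0 ≤ ξ →
          ∫⁻ x in U, ENNReal.ofReal ((ξ + t * g x)⁻¹ ^ k * (g x ^ k * W x)) =
            ∫⁻ x in U, K ξ x * h x := by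
        intro ξ hξ
        refine setLIntegral_congr_fun hU fun x hx => ?_
        have hgx := hg x hx
        exact ENNReal.ofReal_mul (by positivity)
      have hmh : ∫⁻ x in U, m x * h x =
          ENNReal.ofReal ((k * Q - 1) ^ (-(1 / Q)) * t ^ (-((k : ℝ) - 1 / Q))) *
            ∫⁻ x in U, ENNReal.ofReal (g x ^ (1 / Q) * W x) := by
        rw [← lintegral_const_mul' _ _ ENNReal.ofReal_ne_top]
        refine setLIntegral_congr_fun hU fun x hx => ?_
        have hgx := hg x hx
        simp only [hm, hh]
        rw [← ENNReal.ofReal_mul (by positivity), ← ENNReal.ofReal_mul (by positivity),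
          Real.mul_rpow ht.le hgx.le,
          show g x ^ (1 / Q) = g x ^ (-((k : ℝ) - 1 / Q)) * g x ^ k by
            rw [← Real.rpow_natCast, ← Real.rpow_add hgx]
            congr 1
            ring]
        congr 1
        ring
      rw [← hmh, eLpNorm_eq_lintegral_rpow_enorm_toReal (by positivity) hqtop, ← hQ,
        one_div, ENNReal.rpow_inv_le_iff hQ0, ENNReal.mul_rpow_of_nonneg _ _ hQ0.le]
      calc ∫⁻ ξ in Ici 0, ‖F ξ‖ₑ ^ Q
          ≤ ∫⁻ ξ in Ici 0, (C : ENNReal) ^ Q * (∫⁻ x in U, K ξ x * h x) ^ Q := by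
            refine setLIntegral_mono' measurableSet_Ici fun ξ hξ => ?_
            rw [← ENNReal.mul_rpow_of_nonneg _ _ hQ0.le, ← hKh ξ hξ]
            exact ENNReal.rpow_le_rpow (hF ξ hξ) hQ0.le
        _ = (C : ENNReal) ^ Q * ∫⁻ ξ in Ici 0, (∫⁻ x in U, K ξ x * h x) ^ Q :=
            lintegral_const_mul' _ _ (ENNReal.rpow_ne_top_of_nonneg hQ0.le ENNReal.coe_ne_top)
        _ ≤ _ := by gcongr
    · have hg2 : AEMeasurable (fun z : ℝ × ℝ => g z.2)
          ((volume.restrict (Ici (0 : ℝ))).prod (volume.restrict U)) :=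
        hgm.comp_quasiMeasurePreserving Measure.quasiMeasurePreserving_snd
      exact (((measurable_fst.aemeasurable.add (hg2.const_mul t)).inv).pow_const k).ennreal_ofReal
    · intro ξ
      exact ((hgm.const_mul t).const_add ξ).inv.pow_const k |>.ennreal_ofReal
    · intro x
      exact Measurable.aemeasurable (by fun_prop)
    · exact (((hgm.const_mul t).pow_const _).const_mul _).ennreal_ofReal
    · exact ((hgm.pow_const k).mul hWm).ennreal_ofReal
    · filter_upwards [hU'] with x hx
      have hgx := hg x hx
      refine ⟨?_, ENNReal.ofReal_ne_top⟩
      rw [← pos_iff_ne_zero, ENNReal.ofReal_pos]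
      positivity
    · filter_upwards [hU'] with x hx
      have hgx := hg x hx
      have htg : 0 < t * g x := by positivity
      have h1 : ∫⁻ ξ in Ici (0 : ℝ), K ξ x ^ Q =
          ∫⁻ ξ in Ici (0 : ℝ), ENNReal.ofReal ((ξ + t * g x) ^ (-(k * Q))) := by
        refine setLIntegral_congr_fun measurableSet_Ici fun ξ hξ => ?_
        have hξ0 : (0 : ℝ) ≤ ξ := hξ
        simp only [hK]
        rw [ENNReal.ofReal_rpow_of_nonneg (by positivity) hQ0.le, inv_pow,
          Real.inv_rpow (by positivity), ← Real.rpow_natCast, ← Real.rpow_mul (by positivity),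
          Real.rpow_neg (by positivity)]
      rw [h1, lintegral_Ici_ofReal_add_rpow hkQ htg,
        ENNReal.ofReal_rpow_of_nonneg (by positivity) hQ0.le,
        Real.mul_rpow (x := (k * Q - 1) ^ (-(1 / Q))) (by positivity) (by positivity),
        ← Real.rpow_mul (by positivity),
        ← Real.rpow_mul (by positivity), neg_mul, one_div_mul_cancel hQ0.ne',
        Real.rpow_neg_one, neg_mul, sub_mul, one_div_mul_cancel hQ0.ne', neg_sub,
        inv_mul_eq_div]

theorem tsupport_subset_of_hasDerivAt {N : ℕ} {Df : ℕ → ℝ → ℂ}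
    (hDf : ∀ i < N, ∀ x : ℝ, HasDerivAt (Df i) (Df (i + 1) x) x) {β : ℕ} (hβ : β ≤ N) :
    tsupport (Df β) ⊆ tsupport (Df 0) := by
  induction β with
  | zero => exact subset_rfl
  | succ β ih =>
    have h : Df (β + 1) = deriv (Df β) := funext fun x => (hDf β (by omega) x).deriv.symm
    rw [h]
    exact (closure_minimal support_deriv_subset (isClosed_tsupport _)).trans (ih (by omega))

theorem exists_lt_notMem_of_isCompact {K : Set ℝ} (hK : IsCompact K) (x₀ : ℝ) :
    ∃ a < x₀, a ∉ K := by
  obtain ⟨m, hm⟩ := hK.bddBelow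
  refine ⟨min m x₀ - 1, by linarith [min_le_right m x₀], fun h => ?_⟩
  linarith [hm h, min_le_left m x₀]

theorem exists_gt_notMem_of_isCompact {K : Set ℝ} (hK : IsCompact K) (x₀ : ℝ) :
    ∃ b > x₀, b ∉ K := by
  obtain ⟨m, hm⟩ := hK.bddAbove
  refine ⟨max m x₀ + 1, by linarith [le_max_right m x₀], fun h => ?_⟩
  linarith [hm h, le_max_left m x₀]

/-- With the convention that nonintegrable functions have integral zero, a compactly supported
continuous primitive of a function that is not locally integrable vanishes. -/
theorem eq_zero_of_not_locallyIntegrable {F F' : ℝ → ℂ} (hF : Continuous F)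
    (hFs : HasCompactSupport F) (hFF' : ∀ a b : ℝ, F b - F a = ∫ x in a..b, F' x)
    (hF' : ¬ LocallyIntegrable F' volume) : F = 0 := by
  obtain ⟨x₀, hx₀⟩ : ∃ x₀, ¬ IntegrableAtFilter F' (nhds x₀) volume := by
    simpa [LocallyIntegrable] using hF'
  have heq : ∀ a b, a < x₀ → x₀ < b → F b = F a := by
    intro a b ha hb
    rw [← sub_eq_zero, hFF', intervalIntegral.integral_undef]
    intro h
    rw [intervalIntegrable_iff_integrableOn_Ioc_of_le (ha.trans hb).le] at h
    exact hx₀ ⟨_, Ioc_mem_nhds ha hb, h⟩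
  obtain ⟨a, ha, haF⟩ := exists_lt_notMem_of_isCompact hFs.isCompact x₀
  obtain ⟨b, hb, hbF⟩ := exists_gt_notMem_of_isCompact hFs.isCompact x₀
  refine hF.ext_on (dense_compl_singleton x₀) continuous_zero fun x hx => ?_
  rcases lt_or_gt_of_ne hx with hx | hx
  · rw [← heq x b hx hb, image_eq_zero_of_notMem_tsupport hbF, Pi.zero_apply]
  · rw [heq a x ha hx, image_eq_zero_of_notMem_tsupport haF, Pi.zero_apply]

theorem eq_zero_of_hasDerivAt_of_eq_zero {N : ℕ} {Df : ℕ → ℝ → ℂ}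
    (hDf : ∀ i < N, ∀ x : ℝ, HasDerivAt (Df i) (Df (i + 1) x) x)
    (hs : HasCompactSupport (Df 0)) (hN : Df N = 0) : Df 0 = 0 := by
  induction N with
  | zero => exact hN
  | succ N ih =>
    refine ih (fun i hi => hDf i (by omega)) ?_
    have hd : ∀ x, HasDerivAt (Df N) 0 x := fun x => by
      simpa [hN] using hDf N (by omega) x
    obtain ⟨a, -, ha⟩ := exists_lt_notMem_of_isCompact hs.isCompact 0
    funext x
    rw [is_const_of_deriv_eq_zero (fun x => (hd x).differentiableAt) (fun x => (hd x).deriv) x a]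
    exact image_eq_zero_of_notMem_tsupport fun h =>
      ha (tsupport_subset_of_hasDerivAt hDf (by omega) h)

theorem isPhaseAmplitude_of_hasDerivAt {k : ℕ} (hk : 1 ≤ k) {U : Set ℝ} (hU : IsOpen U)
    {Θ : ℕ → ℝ → ℝ} {Df : ℕ → ℝ → ℂ}
    (hΘ : ∀ n < k + 1, ∀ x ∈ U, HasDerivAt (Θ n) (Θ (n + 1) x) x)
    (hΘk : ContinuousOn (Θ (k + 1)) U) (hpos : ∀ x ∈ U, 0 < Θ 1 x)
    (hDf : ∀ i < k - 1, ∀ x : ℝ, HasDerivAt (Df i) (Df (i + 1) x) x)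
    (hDfc : Continuous (Df (k - 1)))
    (hDfk : ∀ a b : ℝ, Df (k - 1) b - Df (k - 1) a = ∫ x in a..b, Df k x)
    (hs : HasCompactSupport (Df 0)) (hsU : tsupport (Df 0) ⊆ U)
    (hinteg : LocallyIntegrable (Df k) volume) :
    IsPhaseAmplitude k U (tsupport (Df 0)) Θ Df := by
  have hcont : ∀ β < k, Continuous (Df β) := fun β hβ => by
    rcases Nat.lt_or_ge β (k - 1) with h | h
    · exact continuous_iff_continuousAt.2 fun x => (hDf β h x).continuousAt
    · rwa [show β = k - 1 by omega]
  refine ⟨hU, hs.isCompact, hsU, hΘ, fun n hn => ?_, hpos, hcont, fun β hβ a b => ?_,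
    fun β hβ => tsupport_subset_of_hasDerivAt hDf (by omega), hinteg⟩
  · rcases hn.lt_or_eq with h | rfl
    · exact fun x hx => (hΘ n h x hx).continuousAt.continuousWithinAt
    · exact hΘk
  · rcases Nat.lt_or_ge β (k - 1) with h | h
    · exact (intervalIntegral.integral_eq_sub_of_hasDerivAt (fun x _ => hDf β h x)
        ((hcont (β + 1) (by omega)).intervalIntegrable a b)).symm
    · obtain rfl : β = k - 1 := by omega
      rw [hDfk, Nat.sub_add_cancel hk]

namespace IsPhaseAmplitude

variable {k : ℕ} {U K : Set ℝ} {Θ : ℕ → ℝ → ℝ} {Df : ℕ → ℝ → ℂ}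

theorem aemeasurable_phase (h : IsPhaseAmplitude k U K Θ Df) {n : ℕ} (hn : n ≤ k + 1) :
    AEMeasurable (Θ n) (volume.restrict U) :=
  (h.continuousOn n hn).aemeasurable h.isOpen.measurableSet

theorem aemeasurable_fWeighted (h : IsPhaseAmplitude k U K Θ Df) :
    AEMeasurable (fWeighted Df Θ k) (volume.restrict U) := by
  have habs : ∀ n ≤ k + 1, AEMeasurable (fun x => |Θ n x|) (volume.restrict U) := fun n hn =>
    (h.aemeasurable_phase hn).norm
  unfold fWeighted wWeight
  refine Finset.aemeasurable_fun_sum _ fun β hβ => AEMeasurable.mul ?_ ?_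
  · have hβk : β ≤ k := by simpa [Nat.lt_succ_iff] using hβ
    exact (h.locallyIntegrable hβk).aestronglyMeasurable.aemeasurable.restrict.norm
  · refine Finset.aemeasurable_fun_sum _ fun a _ => AEMeasurable.mul ?_ ?_
    · exact (habs 1 (by omega)).pow_const _
    · exact Finset.aemeasurable_fun_prod _ fun i _ => (habs _ (by omega)).pow_const _

end IsPhaseAmplitude

/-- Fourier-side localization estimate: if `θ' > 0` on an open set `U` containing the
compact support of `f` and `kq > 1`, then the `L^q` norm over `ξ ∈ [0,∞)` of
`ξ ↦ ∫ f(x) e^{i(xξ + tθ(x))} dx` is at most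
`C(k,q) t^{−(k−1/q)} ∫_U |θ'|^{1/q} f_{θ,k}` (for `q = ∞`, `1/q` is read as `0`, the value
of `1/q.toReal` in Lean; the right-hand integral is a Lebesgue integral in `[0,∞]`). -/
theorem stmt14 (k : ℕ) (hk : 1 ≤ k) (q : ENNReal) (hq : 1 ≤ q) (hkq : 1 < (k : ENNReal) * q) :
    ∃ C : ℝ, 0 < C ∧
      ∀ (U : Set ℝ), IsOpen U →
      ∀ (θ : ℝ → ℝ) (Θ : ℕ → ℝ → ℝ) (f : ℝ → ℂ) (Df : ℕ → ℝ → ℂ),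
        Θ 0 = θ → Df 0 = f →
        (∀ n < k + 1, ∀ x ∈ U, HasDerivAt (Θ n) (Θ (n + 1) x) x) →
        ContinuousOn (Θ (k + 1)) U →
        (∀ x ∈ U, 0 < Θ 1 x) →
        (∀ i < k - 1, ∀ x : ℝ, HasDerivAt (Df i) (Df (i + 1) x) x) →
        Continuous (Df (k - 1)) →
        (∀ a b : ℝ, Df (k - 1) b - Df (k - 1) a = ∫ x in a..b, Df k x) →
        HasCompactSupport f →
        tsupport f ⊆ U →
        ∀ t : ℝ, 0 < t →
          eLpNorm
              (fun ξ : ℝ =>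
                ∫ x : ℝ, f x * Complex.exp (Complex.I * (((x * ξ : ℝ) : ℂ) + (t : ℂ) * ((θ x : ℝ) : ℂ))))
              q (volume.restrict (Set.Ici (0 : ℝ)))
            ≤ ENNReal.ofReal (C * t ^ (-((k : ℝ) - 1 / q.toReal))) *
                ∫⁻ x in U, ENNReal.ofReal (|Θ 1 x| ^ (1 / q.toReal) * fWeighted Df Θ k x) := by
  obtain ⟨C, hC⟩ := exists_enorm_oscillatoryIntegral_le hk k 0 [] (by simp) (by simp)
  obtain ⟨c, hc, hbound⟩ := eLpNorm_le_of_enorm_le_lintegral hq hkq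
  refine ⟨(C + 1) * c, by positivity, ?_⟩
  rintro U hU _ Θ _ Df rfl rfl hΘ hΘk hpos hDf hDfc hDfk hs hsU t ht
  by_cases hinteg : LocallyIntegrable (Df k) volume
  · have h := isPhaseAmplitude_of_hasDerivAt hk hU hΘ hΘk hpos hDf hDfc hDfk hs hsU hinteg
    have h1 := hbound U (Θ 1) (fWeighted Df Θ k)
      (fun ξ : ℝ => ∫ x : ℝ, Df 0 x *
        Complex.exp (Complex.I * (((x * ξ : ℝ) : ℂ) + (t : ℂ) * ((Θ 0 x : ℝ) : ℂ))))
      (C + 1) t hU.measurableSet ht hpos (fun x _ => fWeighted_nonneg Df Θ k x)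
      (h.aemeasurable_phase (by omega)) h.aemeasurable_fWeighted fun ξ hξ => by
        refine le_trans ?_ ((hC U _ Θ Df h t ξ ht hξ).trans ?_)
        · simp [oscillatoryIntegral, phaseFactor, phaseExp]
        · gcongr
          exact le_self_add
    refine h1.trans (le_of_eq ?_)
    rw [← mul_assoc]
    congr 1
    · rw [mul_assoc, ENNReal.ofReal_mul (p := (C : ℝ) + 1) (by positivity)]
      congr 1
      rw [← NNReal.coe_one, ← NNReal.coe_add, ENNReal.ofReal_coe_nnreal]
    · refine setLIntegral_congr_fun hU.measurableSet fun x hx => ?_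
      simp only [abs_of_pos (hpos x hx)]
  · have h0 : Df (k - 1) = 0 := eq_zero_of_not_locallyIntegrable hDfc
      (hs.isCompact.of_isClosed_subset (isClosed_tsupport _)
        (tsupport_subset_of_hasDerivAt hDf le_rfl)) hDfk hinteg
    simp [eq_zero_of_hasDerivAt_of_eq_zero hDf hs h0]
end
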